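/- arXiv:2201.10440 — 3 statements merged into one kernel-verified Lean document; each statement's English description precedes it below -/
import Mathlib

section
/- Under the stated assumptions, the local discretization error of the scheme satisfies ‖Φ_h(u_h)‖_{Y_h}² = ‖U⁰ − u⁰‖² + O(h²) + O(k²); precisely, there exist constants C > 0 and h₀, k₀ > 0, independent of the mesh, such that whenever h ≤ h₀ and k ≤ k₀, one has ‖Φ_h(u_h)‖_{Y_h}² ≤ ‖U⁰ − u⁰‖² + C(h² + k²), where U⁰ᵢ = u₀(xᵢ) for 1 ≤ i ≤ M−1. -/
open scoped BigOperators

noncomputable section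

/-- Composite quadrature rule `Q_h`. -/
def Qh (h : ℝ) (M' : ℕ) (V : ℕ → ℝ) : ℝ :=
  (4*h/3) * (2*V 1 - V 2 + 2*V 3)
    + (h/3) * ∑ i ∈ Finset.Icc 2 M', (V (2*i) + 4*V (2*i+1) + V (2*i+2))
    + (4*h/3) * (2*V (2*M'+3) - V (2*M'+4) + 2*V (2*M'+5))

/-- `‖V‖² = Σ_{i=1}^{M-1} h |V_i|²`. -/
def normSq (h : ℝ) (M : ℕ) (V : ℕ → ℝ) : ℝ :=
  ∑ i ∈ Finset.Icc 1 (M-1), h * (V i)^2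

/-- `‖Z‖_*² = Σ_{n=0}^{N} k |Z^n|²`. -/
def starSq (k : ℝ) (N : ℕ) (Z : ℕ → ℝ) : ℝ :=
  ∑ n ∈ Finset.range (N+1), k * (Z n)^2

/-- The norm on `X_h`. -/
def XNorm (h k : ℝ) (M N : ℕ) (V0 : ℕ → ℝ) (V : ℕ → ℕ → ℝ) (VM : ℕ → ℝ) : ℝ :=
  h * (Real.sqrt (starSq k N V0) + Real.sqrt (starSq k N VM))
    + Finset.sup' (Finset.range (N+1)) ⟨0, Finset.mem_range.mpr (Nat.succ_pos N)⟩
        (fun n => Real.sqrt (normSq h M (V n)))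

/-- The square of the norm on `Y_h`. -/
def YNormSq (h k : ℝ) (M N : ℕ) (P0 : ℕ → ℝ) (P : ℕ → ℕ → ℝ) (PM : ℕ → ℝ) : ℝ :=
  starSq k N P0 + normSq h M (P 0) + h * starSq k N PM
    + ∑ n ∈ Finset.Icc 1 N, k * normSq h M (P n)

/-- Extension of an interior vector by the boundary entries. -/
def extV (M : ℕ) (V0 : ℕ → ℝ) (V : ℕ → ℕ → ℝ) (VM : ℕ → ℝ) (n i : ℕ) : ℝ :=
  if i = 0 then V0 n else if i = M then VM n else V n i

/-- Boundary component `P_0^n` of `Φ_h`. -/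
def phiP0 (h : ℝ) (M' : ℕ) (B : ℝ → ℝ → ℝ) (ψ2 : ℝ → ℝ)
    (V0 : ℕ → ℝ) (V : ℕ → ℕ → ℝ) (n : ℕ) : ℝ :=
  (1 + 1/h) * V0 n - (1/h) * V n 1
    - Qh h M' (fun i => B ((i:ℝ)*h) (Qh h M' (fun j => ψ2 ((j:ℝ)*h) * V n j)) * V n i)

/-- Boundary component `P_M^n` of `Φ_h`. -/
def phiPM (h : ℝ) (VM : ℕ → ℝ) (n : ℕ) : ℝ := VM n / h

/-- Interior component `P_i^n` (for `1 ≤ n ≤ N`) of `Φ_h`. -/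
def phiPi (h k : ℝ) (M' : ℕ) (d : ℝ → ℝ → ℝ) (ψ1 : ℝ → ℝ)
    (V0 : ℕ → ℝ) (V : ℕ → ℕ → ℝ) (VM : ℕ → ℝ) (n i : ℕ) : ℝ :=
  (V n i - V (n-1) i)/k
    + (extV (2*(M'+3)) V0 V VM (n-1) i - extV (2*(M'+3)) V0 V VM (n-1) (i-1))/h
    + d ((i:ℝ)*h) (Qh h M' (fun j => ψ1 ((j:ℝ)*h) * V (n-1) j)) * V (n-1) i
    - (extV (2*(M'+3)) V0 V VM (n-1) (i+1) + extV (2*(M'+3)) V0 V VM (n-1) (i-1)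
        - 2 * V (n-1) i)/h^2

/-- Interior component `P_i^n` of `Φ_h`, for all `0 ≤ n ≤ N`. -/
def phiP (h k : ℝ) (M' : ℕ) (d : ℝ → ℝ → ℝ) (ψ1 u0 : ℝ → ℝ)
    (V0 : ℕ → ℝ) (V : ℕ → ℕ → ℝ) (VM : ℕ → ℝ) (n i : ℕ) : ℝ :=
  if n = 0 then V 0 i - u0 ((i:ℝ)*h) else phiPi h k M' d ψ1 V0 V VM n i

/-- A `C¹` real-valued function is Lipschitz on compact convex sets. -/
lemma exists_lipschitz_const {E : Type*} [NormedAddCommGroup E] [NormedSpace ℝ E] {f : E → ℝ}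
    (hf : ContDiff ℝ 1 f) {s : Set E} (hs : IsCompact s) (hc : Convex ℝ s) :
    ∃ K, 0 ≤ K ∧ ∀ x ∈ s, ∀ y ∈ s, |f x - f y| ≤ K * ‖x - y‖ := by
  obtain ⟨K, hK⟩ := hs.exists_bound_of_continuousOn
    (hf.continuous_fderiv one_ne_zero).continuousOn
  refine ⟨max K 0, le_max_right _ _, fun x hx y hy => ?_⟩
  exact hc.norm_image_sub_le_of_norm_fderiv_le
    (fun z _ => hf.differentiable one_ne_zero z)
    (fun z hz => (hK z hz).trans (le_max_left _ _)) hy hx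

/-- First-order Taylor estimate for a function whose derivative is Lipschitz at `x`. -/
lemma abs_taylor_one_le {g g' : ℝ → ℝ} (hg : ∀ z, HasDerivAt g (g' z) z) {K x y : ℝ}
    (hK : 0 ≤ K) (h : ∀ z ∈ Set.uIcc x y, |g' z - g' x| ≤ K * |z - x|) :
    |g y - g x - g' x * (y - x)| ≤ K * |y - x| ^ 2 := by
  have hder : ∀ z, HasDerivAt (fun z => g z - g' x * z) (g' z - g' x) z := fun z => by
    simpa using (hg z).fun_sub ((hasDerivAt_id' z).const_mul (g' x))
  have := (convex_uIcc x y).norm_image_sub_le_of_norm_hasDerivWithin_le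
    (C := K * |y - x|) (fun z _ => (hder z).hasDerivWithinAt)
    (fun z hz => (h z hz).trans
      (mul_le_mul_of_nonneg_left (Set.abs_sub_left_of_mem_uIcc hz) hK))
    Set.left_mem_uIcc Set.right_mem_uIcc
  simp only [Real.norm_eq_abs] at this
  calc _ = |g y - g' x * y - (g x - g' x * x)| := by congr 1; ring
    _ ≤ _ := this
    _ = _ := by ring

/-- Second-order Taylor estimate for a function whose second derivative is Lipschitz at `x`. -/
lemma abs_taylor_two_le {g g' g'' : ℝ → ℝ} (hg : ∀ z, HasDerivAt g (g' z) z)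
    (hg' : ∀ z, HasDerivAt g' (g'' z) z) {K x y : ℝ}
    (hK : 0 ≤ K) (h : ∀ z ∈ Set.uIcc x y, |g'' z - g'' x| ≤ K * |z - x|) :
    |g y - g x - g' x * (y - x) - g'' x * (y - x) ^ 2 / 2| ≤ K * |y - x| ^ 3 := by
  have hder : ∀ z, HasDerivAt (fun z => g z - g' x * z - g'' x * (z - x) ^ 2 / 2)
      (g' z - g' x - g'' x * (z - x)) z := fun z => by
    have h2 : HasDerivAt (fun z => g'' x * (z - x) ^ 2 / 2) (g'' x * (z - x)) z := by
      have := ((((hasDerivAt_id' z).sub_const x).fun_pow 2).const_mul (g'' x)).div_const 2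
      refine this.congr_deriv ?_
      push_cast
      ring
    simpa using ((hg z).fun_sub ((hasDerivAt_id' z).const_mul (g' x))).fun_sub h2
  have := (convex_uIcc x y).norm_image_sub_le_of_norm_hasDerivWithin_le
    (C := K * |y - x| ^ 2) (fun z _ => (hder z).hasDerivWithinAt)
    (fun z hz => (abs_taylor_one_le hg' hK
        (fun w hw => h w (Set.uIcc_subset_uIcc_left hz hw))).trans
      (mul_le_mul_of_nonneg_left
        (pow_le_pow_left₀ (abs_nonneg _) (Set.abs_sub_left_of_mem_uIcc hz) 2) hK))
    Set.left_mem_uIcc Set.right_mem_uIcc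
  simp only [Real.norm_eq_abs] at this
  calc _ = |g y - g' x * y - g'' x * (y - x) ^ 2 / 2
          - (g x - g' x * x - g'' x * (x - x) ^ 2 / 2)| := by congr 1; ring
    _ ≤ _ := this
    _ = _ := by ring

/-- Consistency of a one-sided difference quotient with step `δ` of either sign. -/
lemma abs_diffQuot_sub_le {g g' : ℝ → ℝ} (hg : ∀ z, HasDerivAt g (g' z) z) {K x δ : ℝ}
    (hK : 0 ≤ K) (hδ : δ ≠ 0)
    (h : ∀ z ∈ Set.uIcc x (x + δ), |g' z - g' x| ≤ K * |z - x|) :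
    |(g (x + δ) - g x) / δ - g' x| ≤ K * |δ| := by
  have h1 := abs_taylor_one_le hg hK h
  have hpos : 0 < |δ| := abs_pos.mpr hδ
  have e : (g (x + δ) - g x) / δ - g' x = (g (x + δ) - g x - g' x * (x + δ - x)) / δ := by
    field_simp
    ring
  rw [e, abs_div, div_le_iff₀ hpos]
  calc _ ≤ _ := h1
    _ = _ := by rw [add_sub_cancel_left]; ring

/-- Consistency of the centred second difference quotient. -/
lemma abs_secondDiffQuot_sub_le {g g' g'' : ℝ → ℝ} (hg : ∀ z, HasDerivAt g (g' z) z)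
    (hg' : ∀ z, HasDerivAt g' (g'' z) z) {K x h : ℝ} (hK : 0 ≤ K) (hh : 0 < h)
    (hlip : ∀ z ∈ Set.Icc (x - h) (x + h), |g'' z - g'' x| ≤ K * |z - x|) :
    |(g (x + h) + g (x - h) - 2 * g x) / h ^ 2 - g'' x| ≤ 2 * K * h := by
  have h1 := abs_taylor_two_le hg hg' (x := x) (y := x + h) hK fun z hz => hlip z <| by
    rw [Set.uIcc_of_le (by linarith)] at hz
    exact ⟨by linarith [hz.1], hz.2⟩
  have h2 := abs_taylor_two_le hg hg' (x := x) (y := x - h) hK fun z hz => hlip z <| by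
    rw [Set.uIcc_of_ge (by linarith)] at hz
    exact ⟨hz.1, by linarith [hz.2]⟩
  rw [add_sub_cancel_left, abs_of_pos hh] at h1
  rw [show x - h - x = -h by ring, abs_neg, abs_of_pos hh] at h2
  have e : (g (x + h) + g (x - h) - 2 * g x) / h ^ 2 - g'' x
      = ((g (x + h) - g x - g' x * h - g'' x * h ^ 2 / 2)
        + (g (x - h) - g x - g' x * -h - g'' x * (-h) ^ 2 / 2)) / h ^ 2 := by
    field_simp
    ring
  rw [e, abs_div, abs_of_pos (pow_pos hh 2), div_le_iff₀ (pow_pos hh 2)]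
  calc _ ≤ _ := abs_add_le _ _
    _ ≤ _ := add_le_add h1 h2
    _ = _ := by ring

lemma abs_integral_sub_le {f : ℝ → ℝ} (hf : Continuous f) {K p q c : ℝ} (hK : 0 ≤ K)
    (hc : c ∈ Set.Icc p q) (h : ∀ x ∈ Set.Icc p q, |f x - f c| ≤ K * |x - c|) :
    |(∫ x in p..q, f x) - (q - p) * f c| ≤ K * (q - p) ^ 2 := by
  have hpq : p ≤ q := hc.1.trans hc.2
  have e : (∫ x in p..q, f x) - (q - p) * f c = ∫ x in p..q, (f x - f c) := by
    rw [intervalIntegral.integral_sub (hf.intervalIntegrable _ _)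
      (intervalIntegrable_const), intervalIntegral.integral_const, smul_eq_mul]
  have := intervalIntegral.norm_integral_le_of_norm_le_const (a := p) (b := q)
    (f := fun x => f x - f c) (C := K * (q - p)) fun x hx => by
      rw [Set.uIoc_of_le hpq] at hx
      refine (h x ⟨hx.1.le, hx.2⟩).trans (mul_le_mul_of_nonneg_left ?_ hK)
      rw [abs_le]
      constructor <;> linarith [hc.1, hc.2, hx.1, hx.2]
  rw [e]
  rw [abs_of_nonneg (sub_nonneg.mpr hpq)] at this
  calc _ ≤ _ := this
    _ = _ := by ring

/-- Error of the open (Milne) panel on `[p, p + 4h]`. -/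
lemma abs_milne_sub_integral_le {f : ℝ → ℝ} (hf : Continuous f) {K p h : ℝ} (hK : 0 ≤ K)
    (hh : 0 ≤ h) (hlip : ∀ x ∈ Set.Icc p (p + 4 * h), ∀ y ∈ Set.Icc p (p + 4 * h),
      |f x - f y| ≤ K * |x - y|) :
    |(4 * h / 3) * (2 * f (p + h) - f (p + 2 * h) + 2 * f (p + 3 * h))
      - ∫ x in p..(p + 4 * h), f x| ≤ 22 * K * h ^ 2 := by
  have hc : p + 2 * h ∈ Set.Icc p (p + 4 * h) := ⟨by linarith, by linarith⟩
  have h0 := abs_integral_sub_le hf hK hc fun x hx => hlip x hx _ hc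
  have h1 := hlip (p + h) ⟨by linarith, by linarith⟩ _ hc
  have h3 := hlip (p + 3 * h) ⟨by linarith, by linarith⟩ _ hc
  rw [show p + h - (p + 2 * h) = -h by ring, abs_neg, abs_of_nonneg hh] at h1
  rw [show p + 3 * h - (p + 2 * h) = h by ring, abs_of_nonneg hh] at h3
  have e : (4 * h / 3) * (2 * f (p + h) - f (p + 2 * h) + 2 * f (p + 3 * h))
      - ∫ x in p..(p + 4 * h), f x
      = (8 * h / 3) * ((f (p + h) - f (p + 2 * h)) + (f (p + 3 * h) - f (p + 2 * h)))
        - ((∫ x in p..(p + 4 * h), f x) - (p + 4 * h - p) * f (p + 2 * h)) := by ring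
  rw [e]
  have h4 : |(8 * h / 3) * ((f (p + h) - f (p + 2 * h)) + (f (p + 3 * h) - f (p + 2 * h)))|
      ≤ (8 * h / 3) * (K * h + K * h) := by
    rw [abs_mul, abs_of_nonneg (by positivity)]
    exact mul_le_mul_of_nonneg_left ((abs_add_le _ _).trans (add_le_add h1 h3)) (by positivity)
  have h5 : 0 ≤ K * h ^ 2 := by positivity
  linarith [abs_sub ((8 * h / 3) * ((f (p + h) - f (p + 2 * h)) + (f (p + 3 * h) - f (p + 2 * h))))
    ((∫ x in p..(p + 4 * h), f x) - (p + 4 * h - p) * f (p + 2 * h))]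

/-- Error of the Simpson panel on `[p, p + 2h]`. -/
lemma abs_simpson_sub_integral_le {f : ℝ → ℝ} (hf : Continuous f) {K p h : ℝ} (hK : 0 ≤ K)
    (hh : 0 ≤ h) (hlip : ∀ x ∈ Set.Icc p (p + 2 * h), ∀ y ∈ Set.Icc p (p + 2 * h),
      |f x - f y| ≤ K * |x - y|) :
    |(h / 3) * (f p + 4 * f (p + h) + f (p + 2 * h))
      - ∫ x in p..(p + 2 * h), f x| ≤ 5 * K * h ^ 2 := by
  have hc : p + h ∈ Set.Icc p (p + 2 * h) := ⟨by linarith, by linarith⟩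
  have h0 := abs_integral_sub_le hf hK hc fun x hx => hlip x hx _ hc
  have h1 := hlip p ⟨by linarith, by linarith⟩ _ hc
  have h3 := hlip (p + 2 * h) ⟨by linarith, by linarith⟩ _ hc
  rw [show p - (p + h) = -h by ring, abs_neg, abs_of_nonneg hh] at h1
  rw [show p + 2 * h - (p + h) = h by ring, abs_of_nonneg hh] at h3
  have e : (h / 3) * (f p + 4 * f (p + h) + f (p + 2 * h)) - ∫ x in p..(p + 2 * h), f x
      = (h / 3) * ((f p - f (p + h)) + (f (p + 2 * h) - f (p + h)))
        - ((∫ x in p..(p + 2 * h), f x) - (p + 2 * h - p) * f (p + h)) := by ring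
  rw [e]
  have h4 : |(h / 3) * ((f p - f (p + h)) + (f (p + 2 * h) - f (p + h)))|
      ≤ (h / 3) * (K * h + K * h) := by
    rw [abs_mul, abs_of_nonneg (by positivity)]
    exact mul_le_mul_of_nonneg_left ((abs_add_le _ _).trans (add_le_add h1 h3)) (by positivity)
  have h5 : 0 ≤ K * h ^ 2 := by positivity
  linarith [abs_sub ((h / 3) * ((f p - f (p + h)) + (f (p + 2 * h) - f (p + h))))
    ((∫ x in p..(p + 2 * h), f x) - (p + 2 * h - p) * f (p + h))]

/-- Error of the composite quadrature rule on Lipschitz functions. -/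
lemma abs_Qh_sub_integral_le {f : ℝ → ℝ} (hf : Continuous f) {K a h : ℝ} (hK : 0 ≤ K)
    (hh : 0 ≤ h) {M' : ℕ} (hM' : 0 < M') (ha : ((2 * (M' + 3) : ℕ) : ℝ) * h = a)
    (hlip : ∀ x ∈ Set.Icc 0 a, ∀ y ∈ Set.Icc 0 a, |f x - f y| ≤ K * |x - y|) :
    |Qh h M' (fun i => f ((i : ℝ) * h)) - ∫ x in (0 : ℝ)..a, f x| ≤ 11 * K * a * h := by
  have hM1 : (1 : ℝ) ≤ M' := by exact_mod_cast hM'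
  push_cast at ha
  have hMh : 0 ≤ (M' : ℝ) * h := by positivity
  have sub : ∀ {p q : ℝ}, 0 ≤ p → q ≤ a → ∀ x ∈ Set.Icc p q, ∀ y ∈ Set.Icc p q,
      |f x - f y| ≤ K * |x - y| := fun hp hq x hx y hy =>
    hlip x ⟨hp.trans hx.1, hx.2.trans hq⟩ y ⟨hp.trans hy.1, hy.2.trans hq⟩
  have hleft := abs_milne_sub_integral_le hf (p := 0) hK hh (sub le_rfl (by linarith))
  have hright := abs_milne_sub_integral_le hf (p := (2 * M' + 2) * h) hK hh
    (sub (by positivity) (by linarith))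
  have hmid : ∀ i ∈ Finset.Icc 2 M',
      |(h / 3) * (f (((2 * i : ℕ) : ℝ) * h) + 4 * f (((2 * i + 1 : ℕ) : ℝ) * h)
        + f (((2 * i + 2 : ℕ) : ℝ) * h))
        - ∫ x in (2 * (i : ℝ) * h)..(2 * ((i + 1 : ℕ) : ℝ) * h), f x| ≤ 5 * K * h ^ 2 := by
    intro i hi
    have hiM : (i : ℝ) ≤ M' := by exact_mod_cast (Finset.mem_Icc.mp hi).2
    have hih : (i : ℝ) * h ≤ M' * h := mul_le_mul_of_nonneg_right hiM hh
    have := abs_simpson_sub_integral_le hf (p := 2 * i * h) hK hh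
      (sub (by positivity) (by linarith))
    push_cast
    convert this using 6 <;> ring_nf
  have hsum : ∑ i ∈ Finset.Icc 2 M', ∫ x in (2 * (i : ℝ) * h)..(2 * ((i + 1 : ℕ) : ℝ) * h), f x
      = ∫ x in (4 * h)..((2 * M' + 2) * h), f x := by
    have := intervalIntegral.sum_integral_adjacent_intervals_Ico (f := f)
      (μ := MeasureTheory.volume)
      (a := fun i : ℕ => 2 * (i : ℝ) * h) (m := 2) (n := M' + 1) (by omega)
      (fun _ _ => hf.intervalIntegrable _ _)
    rw [show Finset.Icc 2 M' = Finset.Ico 2 (M' + 1) from rfl, this]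
    congr 1 <;> push_cast <;> ring
  have hmidsum : |(h / 3) * ∑ i ∈ Finset.Icc 2 M',
        (f (((2 * i : ℕ) : ℝ) * h) + 4 * f (((2 * i + 1 : ℕ) : ℝ) * h)
          + f (((2 * i + 2 : ℕ) : ℝ) * h))
      - ∫ x in (4 * h)..((2 * M' + 2) * h), f x| ≤ M' * (5 * K * h ^ 2) := by
    rw [← hsum, Finset.mul_sum, ← Finset.sum_sub_distrib]
    refine (Finset.abs_sum_le_sum_abs _ _).trans ((Finset.sum_le_sum hmid).trans ?_)
    rw [Finset.sum_const, nsmul_eq_mul]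
    refine mul_le_mul_of_nonneg_right ?_ (by positivity)
    rw [Nat.card_Icc]
    exact_mod_cast (by omega : M' + 1 - 2 ≤ M')
  have hsplit : ∫ x in (0 : ℝ)..a, f x = (∫ x in (0 : ℝ)..(4 * h), f x)
      + (∫ x in (4 * h)..((2 * M' + 2) * h), f x) + ∫ x in ((2 * M' + 2) * h)..a, f x := by
    rw [intervalIntegral.integral_add_adjacent_intervals (hf.intervalIntegrable _ _)
      (hf.intervalIntegrable _ _), intervalIntegral.integral_add_adjacent_intervals
      (hf.intervalIntegrable _ _) (hf.intervalIntegrable _ _)]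
  rw [show ((2 * M' + 2) * h + 4 * h : ℝ) = a by linarith,
    show ((2 * M' + 2) * h + h : ℝ) = ((2 * M' + 3 : ℕ) : ℝ) * h by push_cast; ring,
    show ((2 * M' + 2) * h + 2 * h : ℝ) = ((2 * M' + 4 : ℕ) : ℝ) * h by push_cast; ring,
    show ((2 * M' + 2) * h + 3 * h : ℝ) = ((2 * M' + 5 : ℕ) : ℝ) * h by push_cast; ring]
    at hright
  rw [zero_add, zero_add, zero_add, zero_add,
    show h = ((1 : ℕ) : ℝ) * h by simp, show 2 * (((1 : ℕ) : ℝ) * h) = ((2 : ℕ) : ℝ) * h by simp,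
    show 3 * (((1 : ℕ) : ℝ) * h) = ((3 : ℕ) : ℝ) * h by simp] at hleft
  simp only [Nat.cast_one, one_mul] at hleft
  have hKa : 11 * K * a * h = 22 * K * h ^ 2 + 22 * K * h ^ 2 + M' * (5 * K * h ^ 2)
      + (17 * M' + 22) * (K * h ^ 2) := by rw [← ha]; ring
  have hpos : 0 ≤ (17 * (M' : ℝ) + 22) * (K * h ^ 2) := by positivity
  rw [hsplit, hKa, Qh]
  simp only [Nat.cast_one, one_mul]
  rw [abs_le] at *
  constructor <;> linarith [hleft.1, hleft.2, hright.1, hright.2, hmidsum.1, hmidsum.2]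

/-- Stability of the quadrature rule in the maximum norm. -/
lemma abs_Qh_sub_Qh_le {h δ : ℝ} (hh : 0 ≤ h) {M' : ℕ} {V W : ℕ → ℝ}
    (hVW : ∀ i, 1 ≤ i → i ≤ 2 * (M' + 3) - 1 → |V i - W i| ≤ δ) :
    |Qh h M' V - Qh h M' W| ≤ 4 * (((2 * (M' + 3) : ℕ) : ℝ) * h) * δ := by
  have hδ : 0 ≤ δ := (abs_nonneg _).trans (hVW 1 le_rfl (by omega))
  have b := fun i hi hi' => abs_le.mp (hVW i hi hi')
  have hmid : |∑ i ∈ Finset.Icc 2 M', (V (2 * i) + 4 * V (2 * i + 1) + V (2 * i + 2))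
      - ∑ i ∈ Finset.Icc 2 M', (W (2 * i) + 4 * W (2 * i + 1) + W (2 * i + 2))|
      ≤ M' * (6 * δ) := by
    rw [← Finset.sum_sub_distrib]
    refine (Finset.abs_sum_le_sum_abs _ _).trans ((Finset.sum_le_sum (g := fun _ => 6 * δ)
      fun i hi => ?_).trans ?_)
    · obtain ⟨h2, hM⟩ := Finset.mem_Icc.mp hi
      have b0 := b (2 * i) (by omega) (by omega)
      have b1 := b (2 * i + 1) (by omega) (by omega)
      have b2 := b (2 * i + 2) (by omega) (by omega)
      rw [abs_le]
      constructor <;> linarith [b0.1, b0.2, b1.1, b1.2, b2.1, b2.2]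
    · rw [Finset.sum_const, nsmul_eq_mul]
      refine mul_le_mul_of_nonneg_right ?_ (by positivity)
      rw [Nat.card_Icc]
      exact_mod_cast (by omega : M' + 1 - 2 ≤ M')
  have hl : |(2 * V 1 - V 2 + 2 * V 3) - (2 * W 1 - W 2 + 2 * W 3)| ≤ 5 * δ := by
    have b1 := b 1 (by omega) (by omega)
    have b2 := b 2 (by omega) (by omega)
    have b3 := b 3 (by omega) (by omega)
    rw [abs_le]
    constructor <;> linarith [b1.1, b1.2, b2.1, b2.2, b3.1, b3.2]
  have hr : |(2 * V (2 * M' + 3) - V (2 * M' + 4) + 2 * V (2 * M' + 5))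
      - (2 * W (2 * M' + 3) - W (2 * M' + 4) + 2 * W (2 * M' + 5))| ≤ 5 * δ := by
    have b1 := b (2 * M' + 3) (by omega) (by omega)
    have b2 := b (2 * M' + 4) (by omega) (by omega)
    have b3 := b (2 * M' + 5) (by omega) (by omega)
    rw [abs_le]
    constructor <;> linarith [b1.1, b1.2, b2.1, b2.2, b3.1, b3.2]
  have hpos : 0 ≤ (M' : ℝ) * h * δ := by positivity
  have hpos' : 0 ≤ h * δ := by positivity
  have hl' := mul_le_mul_of_nonneg_left hl (show 0 ≤ 4 * h / 3 by positivity)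
  have hr' := mul_le_mul_of_nonneg_left hr (show 0 ≤ 4 * h / 3 by positivity)
  have hm' := mul_le_mul_of_nonneg_left hmid (show 0 ≤ h / 3 by positivity)
  rw [← abs_of_nonneg (show 0 ≤ 4 * h / 3 by positivity), ← abs_mul,
    abs_of_nonneg (show 0 ≤ 4 * h / 3 by positivity), abs_le] at hl' hr'
  rw [← abs_of_nonneg (show 0 ≤ h / 3 by positivity), ← abs_mul,
    abs_of_nonneg (show 0 ≤ h / 3 by positivity), abs_le] at hm'
  rw [Qh, Qh]
  push_cast
  rw [abs_le]
  constructor <;> linarith [hl'.1, hl'.2, hr'.1, hr'.2, hm'.1, hm'.2]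

/-- The quadrature rule is first-order accurate uniformly over a compact parameter set. -/
lemma exists_Qh_error_bound {E : Type*} [NormedAddCommGroup E] [NormedSpace ℝ E]
    {G : ℝ × E → ℝ} (hG : ContDiff ℝ 1 G) {S : Set E} (hS : IsCompact S) (hSc : Convex ℝ S)
    {a : ℝ} (ha : 0 ≤ a) :
    ∃ C, 0 ≤ C ∧ ∀ e ∈ S, ∀ (M' : ℕ) (h : ℝ), 0 < M' → 0 ≤ h →
      ((2 * (M' + 3) : ℕ) : ℝ) * h = a →
      |Qh h M' (fun i => G ((i : ℝ) * h, e)) - ∫ x in (0 : ℝ)..a, G (x, e)| ≤ C * h := by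
  obtain ⟨K, hK, hlip⟩ := exists_lipschitz_const hG ((isCompact_Icc (a := 0) (b := a)).prod hS)
    ((convex_Icc 0 a).prod hSc)
  refine ⟨11 * K * a, by positivity, fun e he M' h hM' hh hha => ?_⟩
  refine abs_Qh_sub_integral_le (f := fun x => G (x, e)) ?_ hK hh hM' hha fun x hx y hy => ?_
  · exact hG.continuous.comp (by fun_prop)
  · simpa [Prod.norm_def] using hlip (x, e) ⟨hx, he⟩ (y, e) ⟨hy, he⟩

lemma hasDerivAt_fst_slice {F : ℝ × ℝ → ℝ} (hF : Differentiable ℝ F) (x t : ℝ) :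
    HasDerivAt (fun ξ => F (ξ, t)) (fderiv ℝ F (x, t) (1, 0)) x :=
  (hF (x, t)).hasFDerivAt.comp_hasDerivAt x ((hasDerivAt_id' x).prodMk (hasDerivAt_const x t))

lemma hasDerivAt_snd_slice {F : ℝ × ℝ → ℝ} (hF : Differentiable ℝ F) (x t : ℝ) :
    HasDerivAt (fun τ => F (x, τ)) (fderiv ℝ F (x, t) (0, 1)) t :=
  (hF (x, t)).hasFDerivAt.comp_hasDerivAt t ((hasDerivAt_const t x).prodMk (hasDerivAt_id' t))

lemma contDiff_fderiv_apply {F : ℝ × ℝ → ℝ} {m n : WithTop ℕ∞} (hF : ContDiff ℝ n F)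
    (hmn : m + 1 ≤ n) (v : ℝ × ℝ) : ContDiff ℝ m fun p => fderiv ℝ F p v :=
  (hF.fderiv_right hmn).clm_apply contDiff_const

lemma continuous_integral_mul {u : ℝ → ℝ → ℝ} (hu : Continuous (Function.uncurry u))
    {ψ : ℝ → ℝ} (hψ : Continuous ψ) (a : ℝ) :
    Continuous fun t => ∫ x in (0 : ℝ)..a, ψ x * u x t := by
  refine intervalIntegral.continuous_parametric_intervalIntegral_of_continuous'
    (f := fun t x => ψ x * u x t) ?_ 0 a
  exact (hψ.comp continuous_snd).mul (hu.comp (continuous_snd.prodMk continuous_fst))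

lemma exists_Icc_abs_bound {u : ℝ → ℝ → ℝ} (hu : Continuous (Function.uncurry u)) (a T : ℝ) :
    ∃ K, 0 ≤ K ∧ ∀ x ∈ Set.Icc 0 a, ∀ t ∈ Set.Icc 0 T, |u x t| ≤ K := by
  obtain ⟨K, hK⟩ := ((isCompact_Icc (a := 0) (b := a)).prod
    (isCompact_Icc (a := 0) (b := T))).exists_bound_of_continuousOn hu.continuousOn
  exact ⟨max K 0, le_max_right _ _, fun x hx t ht =>
    (hK (x, t) ⟨hx, ht⟩).trans (le_max_left _ _)⟩

/-- By continuity, the differential equation persists at the initial time. -/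
lemma pde_on_Icc {adag T : ℝ} (hT : 0 < T) {d : ℝ → ℝ → ℝ} {u : ℝ → ℝ → ℝ} {s1 : ℝ → ℝ}
    (hd : Continuous (Function.uncurry d)) (hs1 : Continuous s1)
    (hu : ContDiff ℝ 3 (Function.uncurry u))
    (hPDE : ∀ x ∈ Set.Ioo 0 adag, ∀ t ∈ Set.Ioc 0 T,
      deriv (fun τ => u x τ) t + deriv (fun ξ => u ξ t) x + d x (s1 t) * u x t
        = deriv (deriv (fun ξ => u ξ t)) x) :
    ∀ x ∈ Set.Ioo 0 adag, ∀ t ∈ Set.Icc 0 T,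
      fderiv ℝ (Function.uncurry u) (x, t) (0, 1) + fderiv ℝ (Function.uncurry u) (x, t) (1, 0)
        + d x (s1 t) * u x t
        = fderiv ℝ (fun p => fderiv ℝ (Function.uncurry u) p (1, 0)) (x, t) (1, 0) := by
  intro x hx
  have hux : ContDiff ℝ 2 fun p => fderiv ℝ (Function.uncurry u) p (1, 0) :=
    contDiff_fderiv_apply hu (by norm_num) _
  have hut : ContDiff ℝ 2 fun p => fderiv ℝ (Function.uncurry u) p (0, 1) :=
    contDiff_fderiv_apply hu (by norm_num) _
  have huxx : ContDiff ℝ 1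
      fun p => fderiv ℝ (fun p => fderiv ℝ (Function.uncurry u) p (1, 0)) p (1, 0) :=
    contDiff_fderiv_apply hux (by norm_num) _
  have hdu := hu.differentiable (by norm_num)
  have hslice : Continuous fun t : ℝ => (x, t) := by fun_prop
  rw [← closure_Ioc hT.ne]
  refine Set.EqOn.closure (fun t ht => ?_) ?_ (huxx.continuous.comp hslice)
  · have hx1 : deriv (fun ξ => u ξ t) = fun y => fderiv ℝ (Function.uncurry u) (y, t) (1, 0) :=
      funext fun y => (hasDerivAt_fst_slice hdu y t).deriv
    have := hPDE x hx t ht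
    rw [hx1, (hasDerivAt_fst_slice (hux.differentiable (by norm_num)) x t).deriv] at this
    have ht1 : deriv (fun τ => u x τ) t = fderiv ℝ (Function.uncurry u) (x, t) (0, 1) :=
      (hasDerivAt_snd_slice hdu x t).deriv
    rw [← this, ht1]
  · exact ((hut.continuous.comp hslice).add (hux.continuous.comp hslice)).add
      ((hd.comp (continuous_const.prodMk hs1)).mul (hu.continuous.comp hslice))

/-- Uniform truncation error of the interior difference equations. -/
lemma exists_interior_error_bound {adag T : ℝ} (hadag : 0 < adag) (hT : 0 < T)
    {d : ℝ → ℝ → ℝ} {ψ1 : ℝ → ℝ} {u : ℝ → ℝ → ℝ} {s1 : ℝ → ℝ}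
    (hs1 : ∀ t : ℝ, s1 t = ∫ x in (0 : ℝ)..adag, ψ1 x * u x t)
    (hd : Continuous (Function.uncurry d)) (hψ1 : ContDiff ℝ 1 ψ1)
    {L : ℝ} (hL : 0 ≤ L) (hdLip : ∀ x s s' : ℝ, |d x s - d x s'| ≤ L * |s - s'|)
    (hu : ContDiff ℝ 3 (Function.uncurry u))
    (hPDE : ∀ x ∈ Set.Ioo 0 adag, ∀ t ∈ Set.Ioc 0 T,
      deriv (fun τ => u x τ) t + deriv (fun ξ => u ξ t) x + d x (s1 t) * u x t
        = deriv (deriv (fun ξ => u ξ t)) x) :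
    ∃ C, 0 ≤ C ∧ ∀ (M' N : ℕ) (h k : ℝ), 0 < M' → 0 < h → 0 < k →
      ((2 * (M' + 3) : ℕ) : ℝ) * h = adag → (N : ℝ) * k = T →
      ∀ n i : ℕ, n < N → 1 ≤ i → i ≤ 2 * (M' + 3) - 1 →
        |phiPi h k M' d ψ1 (fun n => u 0 ((n : ℝ) * k)) (fun n i => u ((i : ℝ) * h) ((n : ℝ) * k))
          (fun n => u adag ((n : ℝ) * k)) (n + 1) i| ≤ C * (h + k) := by
  set ux : ℝ × ℝ → ℝ := fun p => fderiv ℝ (Function.uncurry u) p (1, 0)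
  set ut : ℝ × ℝ → ℝ := fun p => fderiv ℝ (Function.uncurry u) p (0, 1)
  set uxx : ℝ × ℝ → ℝ := fun p => fderiv ℝ ux p (1, 0)
  have hux : ContDiff ℝ 2 ux := contDiff_fderiv_apply hu (by norm_num) _
  have hut : ContDiff ℝ 2 ut := contDiff_fderiv_apply hu (by norm_num) _
  have huxx : ContDiff ℝ 1 uxx := contDiff_fderiv_apply hux (by norm_num) _
  have hdu := hu.differentiable (by norm_num)
  have hrc := (isCompact_Icc (a := 0) (b := adag)).prod (isCompact_Icc (a := 0) (b := T))
  have hrv : Convex ℝ (Set.Icc 0 adag ×ˢ Set.Icc 0 T) := (convex_Icc 0 adag).prod (convex_Icc 0 T)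
  obtain ⟨Kx, hKx, hlx⟩ := exists_lipschitz_const (hux.of_le (by norm_num)) hrc hrv
  obtain ⟨Kt, hKt, hlt⟩ := exists_lipschitz_const (hut.of_le (by norm_num)) hrc hrv
  obtain ⟨Kxx, hKxx, hlxx⟩ := exists_lipschitz_const huxx hrc hrv
  obtain ⟨U, hU, hUb⟩ := exists_Icc_abs_bound hu.continuous adag T
  obtain ⟨Cq, hCq, hq⟩ := exists_Qh_error_bound (G := fun p : ℝ × ℝ => ψ1 p.1 * u p.1 p.2)
    ((hψ1.comp contDiff_fst).mul (hu.of_le (by norm_num))) (isCompact_Icc (a := 0) (b := T))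
    (convex_Icc 0 T) hadag.le
  have hs1c : Continuous s1 := by
    rw [funext hs1]
    exact continuous_integral_mul hu.continuous hψ1.continuous adag
  have hpde := pde_on_Icc hT hd hs1c hu hPDE
  refine ⟨Kt + Kx + L * Cq * U + 2 * Kxx, by positivity, ?_⟩
  intro M' N h k hM' hh hk hha hkT n i hn hi1 hi2
  have hext : ∀ j : ℕ, extV (2 * (M' + 3)) (fun n => u 0 ((n : ℝ) * k))
      (fun n i => u ((i : ℝ) * h) ((n : ℝ) * k)) (fun n => u adag ((n : ℝ) * k)) n j
      = u ((j : ℝ) * h) ((n : ℝ) * k) := by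
    intro j
    unfold extV
    split_ifs with h0 hM
    · simp [h0]
    · rw [hM, hha]
    · rfl
  have hnN : (n : ℝ) + 1 ≤ N := by exact_mod_cast hn
  have hnk : ((n : ℝ) + 1) * k ≤ T := hkT ▸ mul_le_mul_of_nonneg_right hnN hk.le
  have hi1' : (1 : ℝ) ≤ i := by exact_mod_cast hi1
  have hi2' : (i : ℝ) + 1 ≤ ((2 * (M' + 3) : ℕ) : ℝ) := by
    exact_mod_cast (by omega : i + 1 ≤ 2 * (M' + 3))
  have hxl : h ≤ (i : ℝ) * h := le_mul_of_one_le_left hh.le hi1'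
  have hxr : (i : ℝ) * h + h ≤ adag := by
    rw [← hha]
    linarith [mul_le_mul_of_nonneg_right hi2' hh.le]
  have hn0 : 0 ≤ (n : ℝ) * k := by positivity
  simp only [phiPi, Nat.add_sub_cancel, hext]
  rw [Nat.cast_sub hi1]
  push_cast
  rw [show ((i : ℝ) - 1) * h = i * h - h by ring, show ((i : ℝ) + 1) * h = i * h + h by ring,
    show ((n : ℝ) + 1) * k = n * k + k by ring]
  rw [show ((n : ℝ) + 1) * k = n * k + k by ring] at hnk
  generalize (n : ℝ) * k = t at *
  generalize (i : ℝ) * h = x at *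
  have ht : t ∈ Set.Icc 0 T := ⟨hn0, by linarith⟩
  have hx : x ∈ Set.Icc 0 adag := ⟨by linarith, by linarith⟩
  have et : |(u x (t + k) - u x t) / k - ut (x, t)| ≤ Kt * k := by
    have := abs_diffQuot_sub_le (hasDerivAt_snd_slice hdu x) (x := t) hKt hk.ne' fun z hz => by
      rw [Set.uIcc_of_le (by linarith)] at hz
      simpa [Prod.norm_def] using
        hlt (x, z) ⟨hx, hn0.trans hz.1, hz.2.trans hnk⟩ (x, t) ⟨hx, ht⟩
    rwa [abs_of_pos hk] at this
  have ex : |(u x t - u (x - h) t) / h - ux (x, t)| ≤ Kx * h := by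
    have := abs_diffQuot_sub_le (fun y => hasDerivAt_fst_slice hdu y t) (x := x) hKx
      (neg_ne_zero.mpr hh.ne') fun z hz => by
        rw [Set.uIcc_of_ge (by linarith)] at hz
        simpa [Prod.norm_def] using
          hlx (z, t) ⟨⟨by linarith [hz.1], by linarith [hz.2]⟩, ht⟩ (x, t) ⟨hx, ht⟩
    rw [abs_neg, abs_of_pos hh] at this
    convert this using 3
    rw [← neg_div_neg_eq, neg_sub]
    rfl
  have exx : |(u (x + h) t + u (x - h) t - 2 * u x t) / h ^ 2 - uxx (x, t)| ≤ 2 * Kxx * h :=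
    abs_secondDiffQuot_sub_le (fun y => hasDerivAt_fst_slice hdu y t)
      (fun y => hasDerivAt_fst_slice (hux.differentiable (by norm_num)) y t) hKxx hh
      fun z hz => by
        simpa [Prod.norm_def] using
          hlxx (z, t) ⟨⟨by linarith [hz.1], by linarith [hz.2]⟩, ht⟩ (x, t) ⟨hx, ht⟩
  have eq := hq t ht M' h hM' hh.le hha
  simp only [← hs1] at eq
  generalize Qh h M' _ = Q at *
  have ed : |(d x Q - d x (s1 t)) * u x t| ≤ L * Cq * U * h := by
    rw [abs_mul]
    calc _ ≤ (L * (Cq * h)) * U := mul_le_mul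
          ((hdLip _ _ _).trans (mul_le_mul_of_nonneg_left eq hL)) (hUb x hx t ht)
          (abs_nonneg _) (by positivity)
      _ = _ := by ring
  have hp : ut (x, t) + ux (x, t) + d x (s1 t) * u x t = uxx (x, t) :=
    hpde x ⟨by linarith, by linarith⟩ t ht
  have hC : 0 ≤ Kt * h + (Kx + L * Cq * U + 2 * Kxx) * k := by positivity
  rw [abs_le] at *
  constructor <;> linarith [et.1, et.2, ex.1, ex.2, exx.1, exx.2, ed.1, ed.2]

/-- Uniform truncation error of the discretized Robin boundary condition. -/
lemma exists_boundary_error_bound {adag T : ℝ} (hadag : 0 < adag)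
    {B : ℝ → ℝ → ℝ} {ψ2 : ℝ → ℝ} {u : ℝ → ℝ → ℝ} {s2 : ℝ → ℝ}
    (hs2 : ∀ t : ℝ, s2 t = ∫ x in (0 : ℝ)..adag, ψ2 x * u x t)
    (hB : ContDiff ℝ 1 (Function.uncurry B)) (hψ2 : ContDiff ℝ 1 ψ2)
    {L : ℝ} (hL : 0 ≤ L) (hBLip : ∀ x s s' : ℝ, |B x s - B x s'| ≤ L * |s - s'|)
    (hu : ContDiff ℝ 2 (Function.uncurry u))
    (hRobin : ∀ t ∈ Set.Icc (0 : ℝ) T,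
      u 0 t - deriv (fun ξ => u ξ t) 0 = ∫ x in (0 : ℝ)..adag, B x (s2 t) * u x t) :
    ∃ C, 0 ≤ C ∧ ∀ (M' N : ℕ) (h k : ℝ), 0 < M' → 0 < h → 0 < k →
      ((2 * (M' + 3) : ℕ) : ℝ) * h = adag → (N : ℝ) * k = T →
      ∀ n : ℕ, n ≤ N →
        |phiP0 h M' B ψ2 (fun n => u 0 ((n : ℝ) * k))
          (fun n i => u ((i : ℝ) * h) ((n : ℝ) * k)) n| ≤ C * h := by
  set ux : ℝ × ℝ → ℝ := fun p => fderiv ℝ (Function.uncurry u) p (1, 0)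
  have hux : ContDiff ℝ 1 ux := contDiff_fderiv_apply hu (by norm_num) _
  have hdu := hu.differentiable (by norm_num)
  obtain ⟨Kx, hKx, hlx⟩ := exists_lipschitz_const hux
    ((isCompact_Icc (a := 0) (b := adag)).prod (isCompact_Icc (a := 0) (b := T)))
    ((convex_Icc 0 adag).prod (convex_Icc 0 T))
  obtain ⟨U, hU, hUb⟩ := exists_Icc_abs_bound hu.continuous adag T
  have hs2c : Continuous s2 := by
    rw [funext hs2]
    exact continuous_integral_mul hu.continuous hψ2.continuous adag
  obtain ⟨S, hS⟩ := (isCompact_Icc (a := 0) (b := T)).exists_bound_of_continuousOn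
    hs2c.continuousOn
  obtain ⟨Cq, hCq, hq⟩ := exists_Qh_error_bound (G := fun p : ℝ × ℝ => ψ2 p.1 * u p.1 p.2)
    ((hψ2.comp contDiff_fst).mul (hu.of_le (by norm_num))) (isCompact_Icc (a := 0) (b := T))
    (convex_Icc 0 T) hadag.le
  have hBu : ContDiff ℝ 1 fun p : ℝ × (ℝ × ℝ) => B p.1 p.2.1 * u p.1 p.2.2 :=
    (hB.comp (contDiff_fst.prodMk (contDiff_fst.comp contDiff_snd))).mul
      ((hu.of_le (by norm_num)).comp (contDiff_fst.prodMk (contDiff_snd.comp contDiff_snd)))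
  obtain ⟨Cb, hCb, hb⟩ := exists_Qh_error_bound hBu
    ((isCompact_Icc (a := -S) (b := S)).prod (isCompact_Icc (a := 0) (b := T)))
    ((convex_Icc _ _).prod (convex_Icc 0 T)) hadag.le
  refine ⟨Kx + 4 * adag * (L * Cq * U) + Cb, by positivity, ?_⟩
  intro M' N h k hM' hh hk hha hkT n hn
  have hnN : (n : ℝ) ≤ N := by exact_mod_cast hn
  have hnk : (n : ℝ) * k ≤ T := hkT ▸ mul_le_mul_of_nonneg_right hnN hk.le
  have hn0 : 0 ≤ (n : ℝ) * k := by positivity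
  have hnode : ∀ i : ℕ, i ≤ 2 * (M' + 3) → (i : ℝ) * h ∈ Set.Icc 0 adag := fun i hi =>
    ⟨by positivity, hha ▸ mul_le_mul_of_nonneg_right (by exact_mod_cast hi) hh.le⟩
  have hha' : h ≤ adag := by simpa using (hnode 1 (by omega)).2
  simp only [phiP0, Nat.cast_one, one_mul]
  generalize (n : ℝ) * k = t at *
  have ht : t ∈ Set.Icc 0 T := ⟨hn0, hnk⟩
  have ex : |(u h t - u 0 t) / h - ux (0, t)| ≤ Kx * h := by
    have := abs_diffQuot_sub_le (fun y => hasDerivAt_fst_slice hdu y t) (x := 0) hKx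
      hh.ne' fun z hz => by
        rw [Set.uIcc_of_le (by linarith), zero_add] at hz
        simpa [Prod.norm_def] using
          hlx (z, t) ⟨⟨hz.1, hz.2.trans hha'⟩, ht⟩ (0, t) ⟨⟨le_rfl, hadag.le⟩, ht⟩
    rwa [abs_of_pos hh, zero_add] at this
  have eq := hq t ht M' h hM' hh.le hha
  simp only [← hs2] at eq
  have eb := hb (s2 t, t) ⟨abs_le.mp (hS t ht), ht⟩ M' h hM' hh.le hha
  simp only at eb
  have hR := hRobin t ht
  have hux0 : deriv (fun ξ => u ξ t) 0 = ux (0, t) := (hasDerivAt_fst_slice hdu 0 t).deriv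
  rw [hux0] at hR
  generalize Qh h M' (fun j => ψ2 ((j : ℝ) * h) * u ((j : ℝ) * h) t) = Q at *
  have es := abs_Qh_sub_Qh_le (M' := M') hh.le (δ := L * Cq * U * h)
    (V := fun i => B ((i : ℝ) * h) Q * u ((i : ℝ) * h) t)
    (W := fun i => B ((i : ℝ) * h) (s2 t) * u ((i : ℝ) * h) t) fun i _ hi => by
      rw [← sub_mul, abs_mul]
      calc _ ≤ (L * (Cq * h)) * U := mul_le_mul
            ((hBLip _ _ _).trans (mul_le_mul_of_nonneg_left eq hL))
            (hUb _ (hnode i (by omega)) t ht) (abs_nonneg _) (by positivity)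
        _ = _ := by ring
  rw [hha] at es
  have e0 : (1 + 1 / h) * u 0 t - 1 / h * u h t = u 0 t - (u h t - u 0 t) / h := by ring
  rw [e0]
  rw [abs_le] at *
  constructor <;> linarith [ex.1, ex.2, eb.1, eb.2, es.1, es.2]

lemma normSq_le {h c : ℝ} {M : ℕ} {V : ℕ → ℝ} (hh : 0 ≤ h)
    (hV : ∀ i, 1 ≤ i → i ≤ M - 1 → |V i| ≤ c) : normSq h M V ≤ M * h * c ^ 2 := by
  have : ∀ i ∈ Finset.Icc 1 (M - 1), h * V i ^ 2 ≤ h * c ^ 2 := fun i hi => by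
    obtain ⟨h1, h2⟩ := Finset.mem_Icc.mp hi
    exact mul_le_mul_of_nonneg_left (sq_le_sq' (abs_le.mp (hV i h1 h2)).1
      (abs_le.mp (hV i h1 h2)).2) hh
  refine (Finset.sum_le_sum this).trans ?_
  rw [Finset.sum_const, nsmul_eq_mul, mul_assoc, Nat.card_Icc]
  exact mul_le_mul_of_nonneg_right (by exact_mod_cast (by omega : M - 1 + 1 - 1 ≤ M))
    (by positivity)

lemma starSq_le {k c : ℝ} {N : ℕ} {Z : ℕ → ℝ} (hk : 0 ≤ k) (hZ : ∀ n, n ≤ N → |Z n| ≤ c) :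
    starSq k N Z ≤ (N + 1) * k * c ^ 2 := by
  have : ∀ n ∈ Finset.range (N + 1), k * Z n ^ 2 ≤ k * c ^ 2 := fun n hn => by
    have := abs_le.mp (hZ n (Nat.lt_succ_iff.mp (Finset.mem_range.mp hn)))
    exact mul_le_mul_of_nonneg_left (sq_le_sq' this.1 this.2) hk
  refine (Finset.sum_le_sum this).trans (le_of_eq ?_)
  rw [Finset.sum_const, nsmul_eq_mul, Finset.card_range]
  push_cast
  ring

/-- **Consistency.** Under the smoothness, Lipschitz and solution hypotheses, the local
discretization error satisfies
`‖Φ_h(u_h)‖_{Y_h}² ≤ ‖U⁰ - u⁰‖² + C (h² + k²)` for `h ≤ h₀`, `k ≤ k₀`,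
with `C, h₀, k₀` independent of the mesh, where `U⁰ᵢ = u₀(xᵢ)`. -/
theorem stmt_0
    (adag T : ℝ) (hadag : 0 < adag) (hT : 0 < T)
    (d B : ℝ → ℝ → ℝ) (ψ1 ψ2 u0 : ℝ → ℝ) (u : ℝ → ℝ → ℝ) (s1 s2 : ℝ → ℝ)
    (hs1 : ∀ t : ℝ, s1 t = ∫ x in (0:ℝ)..adag, ψ1 x * u x t)
    (hs2 : ∀ t : ℝ, s2 t = ∫ x in (0:ℝ)..adag, ψ2 x * u x t)
    (hd0 : ∀ x s : ℝ, 0 ≤ d x s) (hB0 : ∀ x s : ℝ, 0 ≤ B x s)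
    (hd_smooth : ContDiff ℝ (⊤ : ℕ∞) (Function.uncurry d))
    (hB_smooth : ContDiff ℝ (⊤ : ℕ∞) (Function.uncurry B))
    (hψ1 : ContDiff ℝ (⊤ : ℕ∞) ψ1) (hψ2 : ContDiff ℝ (⊤ : ℕ∞) ψ2) (hu0 : ContDiff ℝ (⊤ : ℕ∞) u0)
    (L : ℝ) (hL : 0 < L)
    (hdLip : ∀ x s s' : ℝ, |d x s - d x s'| ≤ L * |s - s'|)
    (hBLip : ∀ x s s' : ℝ, |B x s - B x s'| ≤ L * |s - s'|)
    (hu : ContDiff ℝ 3 (Function.uncurry u))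
    (hu_bdd : ∀ m : ℕ, m ≤ 3 → ∃ K : ℝ, ∀ p : ℝ × ℝ,
      ‖iteratedFDeriv ℝ m (Function.uncurry u) p‖ ≤ K)
    (hPDE : ∀ x ∈ Set.Ioo 0 adag, ∀ t ∈ Set.Ioc 0 T,
      deriv (fun τ => u x τ) t + deriv (fun ξ => u ξ t) x + d x (s1 t) * u x t
        = deriv (deriv (fun ξ => u ξ t)) x)
    (hRobin : ∀ t ∈ Set.Icc (0:ℝ) T,
      u 0 t - deriv (fun ξ => u ξ t) 0 = ∫ x in (0:ℝ)..adag, B x (s2 t) * u x t)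
    (hinit : ∀ x ∈ Set.Ioo (0:ℝ) adag, u x 0 = u0 x)
    (hDir : ∀ t ∈ Set.Icc (0:ℝ) T, u adag t = 0) :
    ∃ C > 0, ∃ h₀ > 0, ∃ k₀ > 0, ∀ M' N : ℕ, 0 < M' → 0 < N →
      let M := 2*(M'+3); let h := adag / (M : ℝ); let k := T / (N : ℝ);
      h ≤ h₀ → k ≤ k₀ →
      let U0h : ℕ → ℝ := fun n => u 0 ((n:ℝ)*k);
      let Uh : ℕ → ℕ → ℝ := fun n i => u ((i:ℝ)*h) ((n:ℝ)*k);
      let UMh : ℕ → ℝ := fun n => u adag ((n:ℝ)*k);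
      YNormSq h k M N
          (fun n => phiP0 h M' B ψ2 U0h Uh n)
          (fun n i => phiP h k M' d ψ1 u0 U0h Uh UMh n i)
          (fun n => phiPM h UMh n)
        ≤ normSq h M (fun i => u0 ((i:ℝ)*h) - u ((i:ℝ)*h) 0) + C * (h^2 + k^2) := by
  obtain ⟨Ci, hCi, hint⟩ := exists_interior_error_bound hadag hT hs1 hd_smooth.continuous
    (hψ1.of_le (by exact_mod_cast le_top)) hL.le hdLip hu hPDE
  obtain ⟨Cb, hCb, hbd⟩ := exists_boundary_error_bound (T := T) hadag hs2
    (hB_smooth.of_le (by exact_mod_cast le_top)) (hψ2.of_le (by exact_mod_cast le_top))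
    hL.le hBLip (hu.of_le (by norm_num)) hRobin
  refine ⟨2 * T * Cb ^ 2 + 2 * T * adag * Ci ^ 2 + 1, by positivity, 1, one_pos, 1, one_pos, ?_⟩
  intro M' N hM' hN M h k _ _ U0h Uh UMh
  have hMpos : (0 : ℝ) < M := by exact_mod_cast (by omega : 0 < M)
  have hNpos : (0 : ℝ) < N := by exact_mod_cast hN
  have hN1 : (1 : ℝ) ≤ N := by exact_mod_cast hN
  have hh : 0 < h := div_pos hadag hMpos
  have hk : 0 < k := div_pos hT hNpos
  have hha : (M : ℝ) * h = adag := mul_div_cancel₀ _ hMpos.ne'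
  have hkT : (N : ℝ) * k = T := mul_div_cancel₀ _ hNpos.ne'
  have hboundary : starSq k N (fun n => phiP0 h M' B ψ2 U0h Uh n) ≤ 2 * T * (Cb * h) ^ 2 := by
    refine (starSq_le hk.le (hbd M' N h k hM' hh hk hha hkT)).trans ?_
    refine mul_le_mul_of_nonneg_right ?_ (sq_nonneg _)
    rw [← hkT]
    linarith [mul_le_mul_of_nonneg_right hN1 hk.le]
  have hinitial : normSq h M (fun i => phiP h k M' d ψ1 u0 U0h Uh UMh 0 i)
      = normSq h M (fun i => u0 ((i : ℝ) * h) - u ((i : ℝ) * h) 0) := by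
    refine Finset.sum_congr rfl fun i _ => ?_
    simp only [phiP, if_true, Uh, Nat.cast_zero, zero_mul]
    ring
  have hDirichlet : starSq k N (fun n => phiPM h UMh n) = 0 := by
    refine Finset.sum_eq_zero fun n hn => ?_
    have hnN : (n : ℝ) ≤ N := by exact_mod_cast Nat.lt_succ_iff.mp (Finset.mem_range.mp hn)
    have : UMh n = 0 := hDir _ ⟨by positivity, hkT ▸ mul_le_mul_of_nonneg_right hnN hk.le⟩
    simp [phiPM, this]
  have hinterior : ∑ n ∈ Finset.Icc 1 N,
      k * normSq h M (fun i => phiP h k M' d ψ1 u0 U0h Uh UMh n i)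
      ≤ T * (adag * (Ci * (h + k)) ^ 2) := by
    have : ∀ n ∈ Finset.Icc 1 N,
        k * normSq h M (fun i => phiP h k M' d ψ1 u0 U0h Uh UMh n i)
        ≤ k * (adag * (Ci * (h + k)) ^ 2) := fun n hn => by
      obtain ⟨h1, h2⟩ := Finset.mem_Icc.mp hn
      obtain ⟨m, rfl⟩ := Nat.exists_eq_succ_of_ne_zero (by omega : n ≠ 0)
      refine mul_le_mul_of_nonneg_left ?_ hk.le
      rw [← hha]
      refine normSq_le hh.le fun i hi1 hi2 => ?_
      rw [phiP, if_neg (Nat.succ_ne_zero m)]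
      exact hint M' N h k hM' hh hk hha hkT m i (by omega) hi1 hi2
    refine (Finset.sum_le_sum this).trans (le_of_eq ?_)
    rw [Finset.sum_const, nsmul_eq_mul, Nat.card_Icc, Nat.add_sub_cancel, ← mul_assoc, hkT]
  have hsq : (h + k) ^ 2 ≤ 2 * (h ^ 2 + k ^ 2) := by linarith [sq_nonneg (h - k)]
  have hb2 : 2 * T * (Cb * h) ^ 2 ≤ 2 * T * Cb ^ 2 * (h ^ 2 + k ^ 2) := by
    rw [mul_pow, ← mul_assoc]
    exact mul_le_mul_of_nonneg_left (by linarith [sq_nonneg k]) (by positivity)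
  have hi2 : T * (adag * (Ci * (h + k)) ^ 2) ≤ 2 * T * adag * Ci ^ 2 * (h ^ 2 + k ^ 2) := by
    calc _ = T * adag * Ci ^ 2 * (h + k) ^ 2 := by ring
      _ ≤ T * adag * Ci ^ 2 * (2 * (h ^ 2 + k ^ 2)) :=
        mul_le_mul_of_nonneg_left hsq (by positivity)
      _ = _ := by ring
  rw [YNormSq, hDirichlet, hinitial]
  linarith [sq_nonneg h, sq_nonneg k]
end
end

section
/- Assume the consistency hypotheses (smooth data, Lipschitz dependence of d and B on s, thrice continuously differentiable bounded solution u). Let r and λ be positive numbers such that k = r·h² = λ·h and λ + 2r ≤ 1, and fix R > 0. Then the discretization Φ_h(U_h) = 0 is stable with thresholds R_h = R·h: there exist h₀ > 0 and S > 0 such that for all h ≤ h₀ and all V_h, W_h ∈ X_h with ‖V_h − u_h‖_{X_h} < R·h and ‖W_h − u_h‖_{X_h} < R·h, one has ‖V_h − W_h‖_{X_h} ≤ S·‖Φ_h(V_h) − Φ_h(W_h)‖_{Y_h}. -/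
open scoped BigOperators

noncomputable section

/-- A family of sampled entries contributes at most the full sum of nonnegative entries. -/
lemma sum_comp_le_sum_Icc {f : ℕ → ℝ} (hf : ∀ i, 0 ≤ f i) {s : Finset ℕ} {m : ℕ} {φ : ℕ → ℕ}
    (hφ : Function.Injective φ) (hs : ∀ i ∈ s, φ i ∈ Finset.Icc 1 m) :
    ∑ i ∈ s, f (φ i) ≤ ∑ i ∈ Finset.Icc 1 m, f i := by
  rw [← Finset.sum_image (f := f) (s := s) (g := φ) (fun x _ y _ hxy => hφ hxy)]
  apply Finset.sum_le_sum_of_subset_of_nonneg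
  · intro j hj
    obtain ⟨i, hi, rfl⟩ := Finset.mem_image.mp hj
    exact hs i hi
  · intro i _ _
    exact hf i

lemma abs_Qh_le {h : ℝ} (hh : 0 ≤ h) (M' : ℕ) (V : ℕ → ℝ) :
    |Qh h M' V| ≤ 16 * (h * ∑ i ∈ Finset.Icc 1 (2 * (M' + 3) - 1), |V i|) := by
  set S := ∑ i ∈ Finset.Icc 1 (2 * (M' + 3) - 1), |V i| with hS
  have hmem : ∀ j, 1 ≤ j → j ≤ 2 * M' + 5 → |V j| ≤ S := fun j h1 h2 =>
    Finset.single_le_sum (f := fun i => |V i|) (fun i _ => abs_nonneg _)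
      (Finset.mem_Icc.mpr ⟨h1, by omega⟩)
  have hmid : |∑ i ∈ Finset.Icc 2 M', (V (2*i) + 4*V (2*i+1) + V (2*i+2))| ≤ 6 * S := by
    have h1 : ∑ i ∈ Finset.Icc 2 M', |V (2*i)| ≤ S :=
      sum_comp_le_sum_Icc (f := fun i => |V i|) (φ := fun i => 2*i) (fun i => abs_nonneg _)
        (fun x y hxy => by simp only at hxy; omega)
        (fun i hi => by simp only [Finset.mem_Icc] at hi ⊢; omega)
    have h2 : ∑ i ∈ Finset.Icc 2 M', |V (2*i+1)| ≤ S :=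
      sum_comp_le_sum_Icc (f := fun i => |V i|) (φ := fun i => 2*i+1) (fun i => abs_nonneg _)
        (fun x y hxy => by simp only at hxy; omega)
        (fun i hi => by simp only [Finset.mem_Icc] at hi ⊢; omega)
    have h3 : ∑ i ∈ Finset.Icc 2 M', |V (2*i+2)| ≤ S :=
      sum_comp_le_sum_Icc (f := fun i => |V i|) (φ := fun i => 2*i+2) (fun i => abs_nonneg _)
        (fun x y hxy => by simp only at hxy; omega)
        (fun i hi => by simp only [Finset.mem_Icc] at hi ⊢; omega)
    calc |∑ i ∈ Finset.Icc 2 M', (V (2*i) + 4*V (2*i+1) + V (2*i+2))|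
        ≤ ∑ i ∈ Finset.Icc 2 M', |V (2*i) + 4*V (2*i+1) + V (2*i+2)| :=
          Finset.abs_sum_le_sum_abs _ _
      _ ≤ ∑ i ∈ Finset.Icc 2 M', (|V (2*i)| + 4*|V (2*i+1)| + |V (2*i+2)|) := by
          apply Finset.sum_le_sum
          intro i _
          refine (abs_add_three _ _ _).trans (le_of_eq ?_)
          rw [abs_mul, abs_of_pos (by norm_num : (0:ℝ) < 4)]
      _ ≤ 6 * S := by
          rw [Finset.sum_add_distrib, Finset.sum_add_distrib, ← Finset.mul_sum]
          linarith
  have key : |4 * (2*V 1 - V 2 + 2*V 3)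
      + (∑ i ∈ Finset.Icc 2 M', (V (2*i) + 4*V (2*i+1) + V (2*i+2)))
      + 4 * (2*V (2*M'+3) - V (2*M'+4) + 2*V (2*M'+5))| ≤ 48 * S := by
    have a1 := abs_le.mp (hmem 1 (by omega) (by omega))
    have a2 := abs_le.mp (hmem 2 (by omega) (by omega))
    have a3 := abs_le.mp (hmem 3 (by omega) (by omega))
    have a4 := abs_le.mp (hmem (2*M'+3) (by omega) (by omega))
    have a5 := abs_le.mp (hmem (2*M'+4) (by omega) (by omega))
    have a6 := abs_le.mp (hmem (2*M'+5) (by omega) (by omega))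
    have a7 := abs_le.mp hmid
    rw [abs_le]
    constructor <;> linarith [a1.1, a1.2, a2.1, a2.2, a3.1, a3.2, a4.1, a4.2, a5.1, a5.2, a6.1,
      a6.2, a7.1, a7.2]
  have e : Qh h M' V = (h/3) * (4 * (2*V 1 - V 2 + 2*V 3)
      + (∑ i ∈ Finset.Icc 2 M', (V (2*i) + 4*V (2*i+1) + V (2*i+2)))
      + 4 * (2*V (2*M'+3) - V (2*M'+4) + 2*V (2*M'+5))) := by
    unfold Qh; ring
  rw [e, abs_mul, abs_of_nonneg (by positivity : 0 ≤ h/3)]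
  calc h/3 * _ ≤ h/3 * (48 * S) := by gcongr
    _ = 16 * (h * S) := by ring

lemma Qh_sub (h : ℝ) (M' : ℕ) (V W : ℕ → ℝ) :
    Qh h M' V - Qh h M' W = Qh h M' (fun i => V i - W i) := by
  have : ∑ i ∈ Finset.Icc 2 M', ((V (2*i) - W (2*i)) + 4*(V (2*i+1) - W (2*i+1))
        + (V (2*i+2) - W (2*i+2)))
      = ∑ i ∈ Finset.Icc 2 M', (V (2*i) + 4*V (2*i+1) + V (2*i+2))
        - ∑ i ∈ Finset.Icc 2 M', (W (2*i) + 4*W (2*i+1) + W (2*i+2)) := by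
    rw [← Finset.sum_sub_distrib]
    exact Finset.sum_congr rfl fun i _ => by ring
  unfold Qh
  rw [this]
  ring

lemma normSq_nonneg {h : ℝ} (hh : 0 ≤ h) (M : ℕ) (V : ℕ → ℝ) : 0 ≤ normSq h M V :=
  Finset.sum_nonneg fun _ _ => by positivity

lemma starSq_nonneg {k : ℝ} (hk : 0 ≤ k) (N : ℕ) (Z : ℕ → ℝ) : 0 ≤ starSq k N Z :=
  Finset.sum_nonneg fun _ _ => by positivity

lemma normSq_le_linear_combination {h : ℝ} (hh : 0 ≤ h) {M : ℕ} {F X Y : ℕ → ℝ} {a b : ℝ}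
    (H : ∀ i ∈ Finset.Icc 1 (M-1), (F i)^2 ≤ a * (X i)^2 + b * (Y i)^2) :
    normSq h M F ≤ a * normSq h M X + b * normSq h M Y := by
  unfold normSq
  rw [Finset.mul_sum, Finset.mul_sum, ← Finset.sum_add_distrib]
  apply Finset.sum_le_sum
  intro i hi
  have := mul_le_mul_of_nonneg_left (H i hi) hh
  linarith

lemma normSq_le_mul {h : ℝ} (hh : 0 ≤ h) {M : ℕ} {F X : ℕ → ℝ} {a : ℝ}
    (H : ∀ i ∈ Finset.Icc 1 (M-1), (F i)^2 ≤ a * (X i)^2) :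
    normSq h M F ≤ a * normSq h M X := by
  have := normSq_le_linear_combination (M := M) (F := F) (a := a) (b := 0) (X := X) (Y := X) hh
    (fun i hi => (H i hi).trans (by simp))
  simpa using this

lemma Qh_sq_le {h a : ℝ} (hh : 0 ≤ h) {M' : ℕ} (hM : h * ((2*(M'+3) : ℕ) : ℝ) = a) (V : ℕ → ℝ) :
    (Qh h M' V)^2 ≤ 256 * a * normSq h (2*(M'+3)) V := by
  set S := ∑ i ∈ Finset.Icc 1 (2 * (M' + 3) - 1), |V i| with hS
  have hS0 : 0 ≤ S := Finset.sum_nonneg fun _ _ => abs_nonneg _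
  have h1 : (Qh h M' V)^2 ≤ (16 * (h * S))^2 := by
    rw [← sq_abs]
    exact pow_le_pow_left₀ (abs_nonneg _) (abs_Qh_le hh M' V) 2
  have h2 : S^2 ≤ ((2*(M'+3) : ℕ) : ℝ) * ∑ i ∈ Finset.Icc 1 (2 * (M' + 3) - 1), (V i)^2 := by
    have := sq_sum_le_card_mul_sum_sq (s := Finset.Icc 1 (2 * (M' + 3) - 1)) (f := fun i => |V i|)
    simp only [sq_abs] at this
    refine this.trans ?_
    apply mul_le_mul_of_nonneg_right _ (Finset.sum_nonneg fun _ _ => sq_nonneg _)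
    have hc : (Finset.Icc 1 (2 * (M' + 3) - 1)).card ≤ 2 * (M' + 3) := by
      rw [Nat.card_Icc]; omega
    exact_mod_cast hc
  have h3 := mul_le_mul_of_nonneg_left h2 (by positivity : 0 ≤ 256 * h^2)
  have h4 : normSq h (2*(M'+3)) V = h * ∑ i ∈ Finset.Icc 1 (2 * (M' + 3) - 1), (V i)^2 := by
    unfold normSq; rw [Finset.mul_sum]
  rw [h4, ← hM]
  linarith

lemma mesh_point_mem {h a : ℝ} (hh : 0 ≤ h) {M i : ℕ} (hM : h * (M : ℝ) = a)
    (hi : i ∈ Finset.Icc 1 (M-1)) : (i:ℝ) * h ∈ Set.Icc 0 a := by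
  have : (i:ℝ) ≤ M := by
    have := (Finset.mem_Icc.mp hi).2
    exact_mod_cast (by omega : i ≤ M)
  refine ⟨by positivity, ?_⟩
  rw [← hM, mul_comm]
  gcongr

lemma Qh_weighted_sq_le {h a Kψ : ℝ} (hh : 0 ≤ h) (ha : 0 ≤ a) {M' : ℕ}
    (hM : h * ((2*(M'+3) : ℕ) : ℝ) = a)
    {ψ : ℝ → ℝ} (hψ : ∀ x ∈ Set.Icc 0 a, |ψ x| ≤ Kψ) (V : ℕ → ℝ) :
    (Qh h M' (fun j => ψ ((j:ℝ)*h) * V j))^2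
      ≤ 256 * a * Kψ^2 * normSq h (2*(M'+3)) V := by
  refine (Qh_sq_le hh hM _).trans ?_
  rw [mul_assoc (256 * a)]
  apply mul_le_mul_of_nonneg_left _ (by positivity)
  apply normSq_le_mul hh
  intro i hi
  have := hψ _ (mesh_point_mem hh hM hi)
  rw [mul_pow]
  apply mul_le_mul_of_nonneg_right _ (sq_nonneg _)
  rw [← sq_abs]
  exact pow_le_pow_left₀ (abs_nonneg _) this 2

/-- The nonlocal reaction term is Lipschitz in the discrete `L²` norm on bounded sets. -/
lemma normSq_reaction_sub_le {h a Kψ K L Kv : ℝ} (hh : 0 ≤ h) (ha : 0 ≤ a) {M' : ℕ}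
    (hM : h * ((2*(M'+3) : ℕ) : ℝ) = a) {ψ : ℝ → ℝ} {g : ℝ → ℝ → ℝ}
    (hψ : ∀ x ∈ Set.Icc 0 a, |ψ x| ≤ Kψ)
    (hLip : ∀ x s s' : ℝ, |g x s - g x s'| ≤ L * |s - s'|) (V W : ℕ → ℝ)
    (hg : ∀ x ∈ Set.Icc 0 a, |g x (Qh h M' (fun j => ψ ((j:ℝ)*h) * V j))| ≤ K)
    (hW : normSq h (2*(M'+3)) W ≤ Kv) :
    normSq h (2*(M'+3)) (fun i =>
        g ((i:ℝ)*h) (Qh h M' (fun j => ψ ((j:ℝ)*h) * V j)) * V i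
        - g ((i:ℝ)*h) (Qh h M' (fun j => ψ ((j:ℝ)*h) * W j)) * W i)
      ≤ (2 * K^2 + 2 * L^2 * (256 * a * Kψ^2) * Kv)
        * normSq h (2*(M'+3)) (fun i => V i - W i) := by
  set sV := Qh h M' (fun j => ψ ((j:ℝ)*h) * V j) with hsV
  set sW := Qh h M' (fun j => ψ ((j:ℝ)*h) * W j) with hsW
  set e := normSq h (2*(M'+3)) (fun i => V i - W i) with he
  have he0 : 0 ≤ e := normSq_nonneg hh _ _
  have hs : (sV - sW)^2 ≤ 256 * a * Kψ^2 * e := by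
    rw [hsV, hsW, Qh_sub]
    have := Qh_weighted_sq_le hh ha hM hψ (fun i => V i - W i)
    simpa only [mul_sub] using this
  have h1 := normSq_le_linear_combination (M := 2*(M'+3)) (a := 2*K^2) (b := 2*L^2*(sV-sW)^2)
    (F := fun i => g ((i:ℝ)*h) sV * V i - g ((i:ℝ)*h) sW * W i)
    (X := fun i => V i - W i) (Y := W) hh (by
      intro i hi
      have b1 : (g ((i:ℝ)*h) sV)^2 ≤ K^2 := by
        rw [← sq_abs]
        exact pow_le_pow_left₀ (abs_nonneg _) (hg _ (mesh_point_mem hh hM hi)) 2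
      have b2 : (g ((i:ℝ)*h) sV - g ((i:ℝ)*h) sW)^2 ≤ L^2 * (sV-sW)^2 := by
        rw [← sq_abs, ← sq_abs (sV - sW), ← mul_pow]
        exact pow_le_pow_left₀ (abs_nonneg _) (hLip _ _ _) 2
      have b3 := mul_le_mul_of_nonneg_right b1 (sq_nonneg (V i - W i))
      have b4 := mul_le_mul_of_nonneg_right b2 (sq_nonneg (W i))
      nlinarith [sq_nonneg (g ((i:ℝ)*h) sV * (V i - W i)
        - (g ((i:ℝ)*h) sV - g ((i:ℝ)*h) sW) * W i)])
  refine h1.trans ?_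
  have h2 : (sV - sW)^2 * normSq h (2*(M'+3)) W ≤ 256 * a * Kψ^2 * e * Kv :=
    mul_le_mul hs hW (normSq_nonneg hh _ _) (by positivity)
  have h3 := mul_le_mul_of_nonneg_left h2 (by positivity : 0 ≤ 2 * L^2)
  linarith

lemma sum_Icc_pred_eq (f : ℕ → ℝ) (m : ℕ) :
    ∑ i ∈ Finset.Icc 1 m, f (i-1) = f 0 + ∑ i ∈ Finset.Icc 1 m, f i - f m := by
  induction m with
  | zero => simp
  | succ m ih =>
    rw [Finset.sum_Icc_succ_top (by omega), Finset.sum_Icc_succ_top (by omega), ih,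
      Nat.add_sub_cancel]
    ring

lemma sum_Icc_succ_eq (f : ℕ → ℝ) (m : ℕ) :
    ∑ i ∈ Finset.Icc 1 m, f (i+1) = ∑ i ∈ Finset.Icc 1 m, f i + f (m+1) - f 1 := by
  induction m with
  | zero => simp
  | succ m ih =>
    rw [Finset.sum_Icc_succ_top (by omega), Finset.sum_Icc_succ_top (by omega), ih]
    ring

lemma sq_convex_combination_add_le {p q r x y z k F : ℝ} (hp : 0 ≤ p) (hq : 0 ≤ q) (hr : 0 ≤ r)
    (hpqr : p + q + r = 1) (hk : 0 ≤ k) :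
    (p * x + q * y + r * z + k * F)^2
      ≤ (1 + k) * (p * x^2 + q * y^2 + r * z^2 + k * F^2) := by
  have h1 : (p * x + q * y + r * z)^2 ≤ p * x^2 + q * y^2 + r * z^2 := by
    have hp' : p = 1 - q - r := by linarith
    have : p * x^2 + q * y^2 + r * z^2 - (p * x + q * y + r * z)^2
        = p * q * (x-y)^2 + p * r * (x-z)^2 + q * r * (y-z)^2 := by
      subst hp'; ring
    have : 0 ≤ p * q * (x-y)^2 + p * r * (x-z)^2 + q * r * (y-z)^2 := by positivity
    linarith
  set A := p * x + q * y + r * z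
  have h2 : (A + k * F)^2 ≤ (1+k) * (A^2 + k * F^2) := by
    nlinarith [mul_nonneg hk (sq_nonneg (A - F))]
  exact h2.trans (mul_le_mul_of_nonneg_left (by linarith) (by linarith))

/-- One step of the explicit upwind scheme, with boundary contributions. -/
lemma normSq_explicit_step_le {h k r lam : ℝ} (hh : 0 ≤ h) (hk : 0 ≤ k) (hr : 0 ≤ r)
    (hlam : 0 ≤ lam) (hcfl : lam + 2*r ≤ 1) {m : ℕ} {X Y F : ℕ → ℝ}
    (hY : ∀ i ∈ Finset.Icc 1 m,
      Y i = (1 - lam - 2*r) * X i + (lam + r) * X (i-1) + r * X (i+1) + k * F i) :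
    normSq h (m+1) Y ≤ (1 + k) * (normSq h (m+1) X + h * ((lam + r) * (X 0)^2 - r * (X 1)^2)
      + h * r * (X (m+1))^2 + k * normSq h (m+1) F) := by
  unfold normSq
  rw [Nat.add_sub_cancel]
  have h1 : ∑ i ∈ Finset.Icc 1 m, h * (Y i)^2 ≤ ∑ i ∈ Finset.Icc 1 m, (1+k) *
      (h * (1 - lam - 2*r) * (X i)^2 + h * (lam + r) * (X (i-1))^2 + h * r * (X (i+1))^2
        + k * (h * (F i)^2)) := by
    apply Finset.sum_le_sum
    intro i hi
    rw [hY i hi]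
    have := mul_le_mul_of_nonneg_left (sq_convex_combination_add_le (x := X i) (y := X (i-1))
      (z := X (i+1)) (F := F i)
      (by linarith : 0 ≤ 1 - lam - 2*r) (by linarith : 0 ≤ lam + r) hr (by ring) hk) hh
    linarith
  refine h1.trans ?_
  rw [← Finset.mul_sum]
  apply mul_le_mul_of_nonneg_left _ (by linarith)
  simp only [Finset.sum_add_distrib, ← Finset.mul_sum]
  rw [sum_Icc_pred_eq (fun i => (X i)^2), sum_Icc_succ_eq (fun i => (X i)^2)]
  have : 0 ≤ h * (lam + r) * (X m)^2 := by positivity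
  linarith

/-- The discrete Robin condition controls the boundary value. -/
lemma robin_sq_le {h x0 x1 G : ℝ} (hh : 0 < h) (hG : (1 + 1/h) * x0 - (1/h) * x1 = G) :
    (1 + h) * x0^2 ≤ x1^2 + h * G^2 := by
  have h1 : (1 + h) * x0 = x1 + h * G := by
    rw [← hG]; field_simp; ring
  have h2 : (1+h) * ((1 + h) * x0^2) ≤ (1+h) * (x1^2 + h * G^2) := by
    have : (1+h) * ((1 + h) * x0^2) = (x1 + h * G)^2 := by rw [← h1]; ring
    rw [this]
    nlinarith [mul_nonneg hh.le (sq_nonneg (x1 - G))]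
  exact le_of_mul_le_mul_left h2 (by linarith)

/-- Discrete Grönwall inequality. -/
lemma exp_discrete_gronwall {e b : ℕ → ℝ} {c : ℝ} {N : ℕ} (hc : 0 ≤ c) (hb : ∀ n, 0 ≤ b n)
    (H : ∀ n < N, e (n+1) ≤ Real.exp c * e n + b (n+1)) :
    ∀ n ≤ N, e n ≤ Real.exp (c * n) * (e 0 + ∑ m ∈ Finset.Icc 1 n, b m) := by
  intro n
  induction n with
  | zero => simp
  | succ n ih =>
    intro hn
    have h1 := H n (by omega)
    have h2 := mul_le_mul_of_nonneg_left (ih (by omega)) (Real.exp_pos c).le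
    have h3 : Real.exp (c * ((n+1 : ℕ) : ℝ)) = Real.exp c * Real.exp (c * n) := by
      rw [← Real.exp_add]; push_cast; ring_nf
    have h4 : (1:ℝ) ≤ Real.exp (c * ((n+1 : ℕ) : ℝ)) := Real.one_le_exp (by positivity)
    rw [Finset.sum_Icc_succ_top (by omega)]
    have h5 := mul_le_mul_of_nonneg_right h4 (hb (n+1))
    have h6 : Real.exp c * (Real.exp (c * n) * (e 0 + ∑ m ∈ Finset.Icc 1 n, b m))
      = Real.exp (c * ((n+1 : ℕ) : ℝ)) * (e 0 + ∑ m ∈ Finset.Icc 1 n, b m) := by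
      rw [h3]; ring
    linarith

lemma normSq_le_of_XNorm_lt {h k ρ : ℝ} (hh : 0 ≤ h) {M N : ℕ} {V0 VM : ℕ → ℝ}
    {V : ℕ → ℕ → ℝ} (H : XNorm h k M N V0 V VM < ρ) {n : ℕ} (hn : n ≤ N) :
    normSq h M (V n) ≤ ρ^2 := by
  have h1 : Real.sqrt (normSq h M (V n)) ≤ ρ := by
    have h2 := Finset.le_sup' (s := Finset.range (N+1)) (fun n => Real.sqrt (normSq h M (V n)))
      (Finset.mem_range.mpr (by omega : n < N+1))
    unfold XNorm at H
    have h3 : 0 ≤ h * (Real.sqrt (starSq k N V0) + Real.sqrt (starSq k N VM)) := by positivity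
    linarith
  exact (Real.sqrt_le_left ((Real.sqrt_nonneg _).trans h1)).mp h1

lemma normSq_le_of_near {h a K ρ : ℝ} (hh : 0 ≤ h) {M : ℕ} (hM : h * (M : ℝ) = a)
    {V w : ℕ → ℝ} (hw : ∀ i, |w i| ≤ K) (H : normSq h M (fun i => V i - w i) ≤ ρ^2) :
    normSq h M V ≤ 2 * ρ^2 + 2 * (a * K^2) := by
  have h1 : normSq h M w ≤ a * K^2 := by
    calc normSq h M w ≤ ∑ i ∈ Finset.Icc 1 (M-1), h * K^2 := by
          apply Finset.sum_le_sum
          intro i _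
          apply mul_le_mul_of_nonneg_left _ hh
          rw [← sq_abs]
          exact pow_le_pow_left₀ (abs_nonneg _) (hw i) 2
      _ = ((M-1 : ℕ) : ℝ) * (h * K^2) := by simp
      _ ≤ (M : ℝ) * (h * K^2) := by
          apply mul_le_mul_of_nonneg_right _ (by positivity)
          exact_mod_cast Nat.sub_le M 1
      _ = a * K^2 := by rw [← hM]; ring
  have h2 := normSq_le_linear_combination (M := M) (F := V) (X := fun i => V i - w i) (Y := w)
    (a := 2) (b := 2) hh (fun i _ => by nlinarith [sq_nonneg (V i - w i - w i)])
  linarith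

/-- The Robin condition bounds the boundary error by the interior error and the residual. -/
lemma boundary_error_sq_le {h a Kψ K L Kv : ℝ} (hh : 0 < h) (ha : 0 ≤ a) {M' : ℕ}
    (hM : h * ((2*(M'+3) : ℕ) : ℝ) = a) {B : ℝ → ℝ → ℝ} {ψ2 : ℝ → ℝ}
    (hψ : ∀ x ∈ Set.Icc 0 a, |ψ2 x| ≤ Kψ)
    (hLip : ∀ x s s' : ℝ, |B x s - B x s'| ≤ L * |s - s'|)
    (V0 W0 : ℕ → ℝ) (V W : ℕ → ℕ → ℝ) (n : ℕ)
    (hB : ∀ x ∈ Set.Icc 0 a, |B x (Qh h M' (fun j => ψ2 ((j:ℝ)*h) * V n j))| ≤ K)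
    (hW : normSq h (2*(M'+3)) (W n) ≤ Kv) :
    (1 + h) * (V0 n - W0 n)^2 ≤ (V n 1 - W n 1)^2
      + h * (2 * (phiP0 h M' B ψ2 V0 V n - phiP0 h M' B ψ2 W0 W n)^2
        + 512 * a * (2 * K^2 + 2 * L^2 * (256 * a * Kψ^2) * Kv)
          * normSq h (2*(M'+3)) (fun i => V n i - W n i)) := by
  set qV := Qh h M' (fun i => B ((i:ℝ)*h) (Qh h M' (fun j => ψ2 ((j:ℝ)*h) * V n j)) * V n i)
    with hqV
  set qW := Qh h M' (fun i => B ((i:ℝ)*h) (Qh h M' (fun j => ψ2 ((j:ℝ)*h) * W n j)) * W n i)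
    with hqW
  set p := phiP0 h M' B ψ2 V0 V n - phiP0 h M' B ψ2 W0 W n with hp
  have h1 : (1 + 1/h) * (V0 n - W0 n) - (1/h) * (V n 1 - W n 1) = p + (qV - qW) := by
    rw [hp]; unfold phiP0; rw [← hqV, ← hqW]; ring
  have h2 : (qV - qW)^2 ≤ 256 * a * ((2 * K^2 + 2 * L^2 * (256 * a * Kψ^2) * Kv)
      * normSq h (2*(M'+3)) (fun i => V n i - W n i)) := by
    rw [hqV, hqW, Qh_sub]
    exact (Qh_sq_le hh.le hM _).trans (mul_le_mul_of_nonneg_left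
      (normSq_reaction_sub_le hh.le ha hM hψ hLip (V n) (W n) hB hW) (by positivity))
  refine (robin_sq_le hh h1).trans ?_
  have h3 : (p + (qV - qW))^2 ≤ 2 * p^2 + 2 * (qV - qW)^2 := by
    nlinarith [sq_nonneg (p - (qV - qW))]
  have h4 := mul_le_mul_of_nonneg_left (h3.trans (by linarith : _ ≤ 2 * p^2
    + 512 * a * (2 * K^2 + 2 * L^2 * (256 * a * Kψ^2) * Kv)
          * normSq h (2*(M'+3)) (fun i => V n i - W n i))) hh.le
  linarith

lemma interior_error_step_eq {h k r lam : ℝ} (hh : 0 < h) (hr : 0 < r) (hk : k = r * h^2)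
    (hlam : k = lam * h) {M' : ℕ} (d : ℝ → ℝ → ℝ) (ψ1 : ℝ → ℝ)
    (V0 VM W0 WM : ℕ → ℝ) (V W : ℕ → ℕ → ℝ) (n : ℕ) {i : ℕ} (hi : i ∈ Finset.Icc 1 (2*M'+5)) :
    V (n+1) i - W (n+1) i =
      (1 - lam - 2*r) * (extV (2*(M'+3)) V0 V VM n i - extV (2*(M'+3)) W0 W WM n i)
      + (lam + r) * (extV (2*(M'+3)) V0 V VM n (i-1) - extV (2*(M'+3)) W0 W WM n (i-1))
      + r * (extV (2*(M'+3)) V0 V VM n (i+1) - extV (2*(M'+3)) W0 W WM n (i+1))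
      + k * ((phiPi h k M' d ψ1 V0 V VM (n+1) i - phiPi h k M' d ψ1 W0 W WM (n+1) i)
        - (d ((i:ℝ)*h) (Qh h M' (fun j => ψ1 ((j:ℝ)*h) * V n j)) * V n i
          - d ((i:ℝ)*h) (Qh h M' (fun j => ψ1 ((j:ℝ)*h) * W n j)) * W n i)) := by
  have hl : lam = r * h := by
    have : lam * h = (r * h) * h := by rw [← hlam, hk]; ring
    exact mul_right_cancel₀ hh.ne' this
  obtain ⟨hi1, hi2⟩ := Finset.mem_Icc.mp hi
  have e1 : ∀ (Z0 ZM : ℕ → ℝ) (Z : ℕ → ℕ → ℝ), extV (2*(M'+3)) Z0 Z ZM n i = Z n i := by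
    intro Z0 ZM Z
    unfold extV
    rw [if_neg (by omega), if_neg (by omega)]
  subst hl
  unfold phiPi
  rw [Nat.add_sub_cancel, e1, e1, hk]
  field_simp
  ring

/-- One-step growth of the discrete `L²` error. -/
lemma normSq_error_step_le {h k r lam a Kψ K L Kv : ℝ} (hh : 0 < h) (ha : 0 ≤ a) (hr : 0 < r)
    (hlam0 : 0 < lam) (hk : k = r * h^2) (hlam : k = lam * h) (hcfl : lam + 2*r ≤ 1) {M' : ℕ}
    (hM : h * ((2*(M'+3) : ℕ) : ℝ) = a) {d B : ℝ → ℝ → ℝ} {ψ1 ψ2 : ℝ → ℝ} (u0 : ℝ → ℝ)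
    (hψ1 : ∀ x ∈ Set.Icc 0 a, |ψ1 x| ≤ Kψ) (hψ2 : ∀ x ∈ Set.Icc 0 a, |ψ2 x| ≤ Kψ)
    (hdLip : ∀ x s s' : ℝ, |d x s - d x s'| ≤ L * |s - s'|)
    (hBLip : ∀ x s s' : ℝ, |B x s - B x s'| ≤ L * |s - s'|)
    (V0 VM W0 WM : ℕ → ℝ) (V W : ℕ → ℕ → ℝ) (n : ℕ)
    (hd : ∀ x ∈ Set.Icc 0 a, |d x (Qh h M' (fun j => ψ1 ((j:ℝ)*h) * V n j))| ≤ K)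
    (hB : ∀ x ∈ Set.Icc 0 a, |B x (Qh h M' (fun j => ψ2 ((j:ℝ)*h) * V n j))| ≤ K)
    (hW : normSq h (2*(M'+3)) (W n) ≤ Kv) :
    normSq h (2*(M'+3)) (fun i => V (n+1) i - W (n+1) i) ≤ (1 + k) *
      ((1 + k * ((512 * a + 2) * (2 * K^2 + 2 * L^2 * (256 * a * Kψ^2) * Kv)))
          * normSq h (2*(M'+3)) (fun i => V n i - W n i)
        + 2 * (k * (phiP0 h M' B ψ2 V0 V n - phiP0 h M' B ψ2 W0 W n)^2
          + h * (k * (phiPM h VM n - phiPM h WM n)^2)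
          + k * normSq h (2*(M'+3)) (fun i => phiP h k M' d ψ1 u0 V0 V VM (n+1) i
              - phiP h k M' d ψ1 u0 W0 W WM (n+1) i))) := by
  have hk0 : 0 < k := by rw [hk]; positivity
  set γ := 2 * K^2 + 2 * L^2 * (256 * a * Kψ^2) * Kv with hγ
  set e := normSq h (2*(M'+3)) (fun i => V n i - W n i) with he
  set P := normSq h (2*(M'+3)) (fun i => phiP h k M' d ψ1 u0 V0 V VM (n+1) i
              - phiP h k M' d ψ1 u0 W0 W WM (n+1) i) with hP
  set p := phiP0 h M' B ψ2 V0 V n - phiP0 h M' B ψ2 W0 W n with hp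
  have hbd := boundary_error_sq_le hh ha hM hψ2 hBLip V0 W0 V W n hB hW
  rw [← hγ, ← he, ← hp] at hbd
  have hD := normSq_reaction_sub_le hh.le ha hM hψ1 hdLip (V n) (W n) hd hW
  rw [← hγ, ← he] at hD
  have hstep := normSq_explicit_step_le hh.le hk0.le hr.le hlam0.le hcfl (m := 2*M'+5)
    (Y := fun i => V (n+1) i - W (n+1) i)
    (X := fun i => extV (2*(M'+3)) V0 V VM n i - extV (2*(M'+3)) W0 W WM n i)
    (fun i hi => interior_error_step_eq hh hr hk hlam d ψ1 V0 VM W0 WM V W n hi)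
  have eM : 2*M'+5+1 = 2*(M'+3) := by ring
  rw [eM] at hstep
  have hX : normSq h (2*(M'+3)) (fun i => extV (2*(M'+3)) V0 V VM n i
      - extV (2*(M'+3)) W0 W WM n i) = e := by
    rw [he]
    unfold normSq
    refine Finset.sum_congr rfl fun i hi => ?_
    have := Finset.mem_Icc.mp hi
    simp only [extV]
    rw [if_neg (by omega), if_neg (by omega), if_neg (by omega), if_neg (by omega)]
  have hX0 : ∀ (Z0 ZM : ℕ → ℝ) (Z : ℕ → ℕ → ℝ), extV (2*(M'+3)) Z0 Z ZM n 0 = Z0 n := by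
    intro Z0 ZM Z; simp [extV]
  have hX1 : ∀ (Z0 ZM : ℕ → ℝ) (Z : ℕ → ℕ → ℝ), extV (2*(M'+3)) Z0 Z ZM n 1 = Z n 1 := by
    intro Z0 ZM Z; unfold extV; rw [if_neg (by omega), if_neg (by omega)]
  have hXM : ∀ (Z0 ZM : ℕ → ℝ) (Z : ℕ → ℕ → ℝ),
      extV (2*(M'+3)) Z0 Z ZM n (2*(M'+3)) = ZM n := by
    intro Z0 ZM Z; unfold extV; rw [if_neg (by omega), if_pos rfl]
  rw [hX] at hstep
  simp only [hX0, hX1, hXM] at hstep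
  have hF := normSq_le_linear_combination (h := h) hh.le (M := 2*(M'+3)) (a := 2) (b := 2)
    (F := fun i => (phiPi h k M' d ψ1 V0 V VM (n+1) i - phiPi h k M' d ψ1 W0 W WM (n+1) i)
        - (d ((i:ℝ)*h) (Qh h M' (fun j => ψ1 ((j:ℝ)*h) * V n j)) * V n i
          - d ((i:ℝ)*h) (Qh h M' (fun j => ψ1 ((j:ℝ)*h) * W n j)) * W n i))
    (X := fun i => phiPi h k M' d ψ1 V0 V VM (n+1) i - phiPi h k M' d ψ1 W0 W WM (n+1) i)
    (Y := fun i => d ((i:ℝ)*h) (Qh h M' (fun j => ψ1 ((j:ℝ)*h) * V n j)) * V n i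
          - d ((i:ℝ)*h) (Qh h M' (fun j => ψ1 ((j:ℝ)*h) * W n j)) * W n i)
    (fun i _ => by
      have (x y : ℝ) : (x - y)^2 ≤ 2 * x^2 + 2 * y^2 := by nlinarith [sq_nonneg (x + y)]
      exact this _ _)
  have hP' : normSq h (2*(M'+3)) (fun i => phiPi h k M' d ψ1 V0 V VM (n+1) i
      - phiPi h k M' d ψ1 W0 W WM (n+1) i) = P := by
    rw [hP]; simp only [phiP, Nat.succ_ne_zero, if_false]
  rw [hP'] at hF
  refine hstep.trans (mul_le_mul_of_nonneg_left ?_ (by linarith))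
  have hkF := mul_le_mul_of_nonneg_left (hF.trans (by linarith : _ ≤ 2 * P + 2 * (γ * e))) hk0.le
  have hl : lam = r * h := by
    have : lam * h = (r * h) * h := by rw [← hlam, hk]; ring
    exact mul_right_cancel₀ hh.ne' this
  have hkb : h * ((lam + r) * (V0 n - W0 n)^2 - r * (V n 1 - W n 1)^2)
      ≤ k * (2 * p^2 + 512 * a * γ * e) := by
    have := mul_le_mul_of_nonneg_left hbd (by positivity : 0 ≤ h * r)
    rw [hl, hk]
    linarith
  have hkM : h * r * (VM n - WM n)^2 = h * (k * (phiPM h VM n - phiPM h WM n)^2) := by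
    rw [hk]; unfold phiPM; field_simp
  have hkM0 : 0 ≤ h * (k * (phiPM h VM n - phiPM h WM n)^2) := by positivity
  rw [hkM]
  linarith

lemma mul_sqrt_le_sqrt {h A C Y : ℝ} (hh : 0 ≤ h) (hC : 0 ≤ C) (H : h^2 * A ≤ C * Y) :
    h * Real.sqrt A ≤ Real.sqrt C * Real.sqrt Y := by
  calc h * Real.sqrt A = Real.sqrt (h^2 * A) := by
        rw [Real.sqrt_mul (sq_nonneg h), Real.sqrt_sq hh]
    _ ≤ Real.sqrt (C * Y) := Real.sqrt_le_sqrt H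
    _ = Real.sqrt C * Real.sqrt Y := Real.sqrt_mul hC _

lemma sum_residuals_le_YNormSq {h k : ℝ} (hh : 0 ≤ h) (hk : 0 ≤ k) (M : ℕ) (P0 PM : ℕ → ℝ)
    (P : ℕ → ℕ → ℝ) {n N : ℕ} (hn : n ≤ N) :
    normSq h M (P 0) + ∑ m ∈ Finset.Icc 1 n, (k * (P0 (m-1))^2 + h * (k * (PM (m-1))^2)
      + k * normSq h M (P m)) ≤ YNormSq h k M N P0 P PM := by
  have h0 : ∀ Z : ℕ → ℝ, ∑ m ∈ Finset.Icc 1 n, k * (Z (m-1))^2 ≤ starSq k N Z := by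
    intro Z
    unfold starSq
    rw [← Finset.sum_image (f := fun m => k * (Z m)^2) (s := Finset.Icc 1 n) (g := fun m => m-1)
      (fun x hx y hy hxy => by
        have := Finset.mem_Icc.mp hx
        have := Finset.mem_Icc.mp hy
        simp only at hxy
        omega)]
    apply Finset.sum_le_sum_of_subset_of_nonneg
    · intro j hj
      obtain ⟨i, hi, rfl⟩ := Finset.mem_image.mp hj
      have := Finset.mem_Icc.mp hi
      exact Finset.mem_range.mpr (by omega)
    · intro i _ _
      positivity
  have h1 : ∑ m ∈ Finset.Icc 1 n, k * normSq h M (P m)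
      ≤ ∑ m ∈ Finset.Icc 1 N, k * normSq h M (P m) :=
    Finset.sum_le_sum_of_subset_of_nonneg (Finset.Icc_subset_Icc_right hn)
      (fun i _ _ => mul_nonneg hk (normSq_nonneg hh _ _))
  have h2 := mul_le_mul_of_nonneg_left (h0 PM) hh
  have h3 := h0 P0
  unfold YNormSq
  rw [Finset.sum_add_distrib, Finset.sum_add_distrib, ← Finset.mul_sum (a := h)]
  linarith

/-- Stability of the scheme, given bounds on the coefficients along the two grid functions. -/
lemma XNorm_sub_le_of_bounds {h k r lam a T Kψ K L Kv : ℝ} (hh : 0 < h) (ha : 0 ≤ a) (hr : 0 < r)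
    (hlam0 : 0 < lam) (hk : k = r * h^2) (hlam : k = lam * h) (hcfl : lam + 2*r ≤ 1) {M' N : ℕ}
    (hM : h * ((2*(M'+3) : ℕ) : ℝ) = a) (hN : k * (N : ℝ) = T) (hN0 : 0 < N) (hKv : 0 ≤ Kv)
    {d B : ℝ → ℝ → ℝ} {ψ1 ψ2 : ℝ → ℝ} (u0 : ℝ → ℝ)
    (hψ1 : ∀ x ∈ Set.Icc 0 a, |ψ1 x| ≤ Kψ) (hψ2 : ∀ x ∈ Set.Icc 0 a, |ψ2 x| ≤ Kψ)
    (hdLip : ∀ x s s' : ℝ, |d x s - d x s'| ≤ L * |s - s'|)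
    (hBLip : ∀ x s s' : ℝ, |B x s - B x s'| ≤ L * |s - s'|)
    (V0 VM W0 WM : ℕ → ℝ) (V W : ℕ → ℕ → ℝ)
    (hd : ∀ n ≤ N, ∀ x ∈ Set.Icc 0 a, |d x (Qh h M' (fun j => ψ1 ((j:ℝ)*h) * V n j))| ≤ K)
    (hB : ∀ n ≤ N, ∀ x ∈ Set.Icc 0 a, |B x (Qh h M' (fun j => ψ2 ((j:ℝ)*h) * V n j))| ≤ K)
    (hW : ∀ n ≤ N, normSq h (2*(M'+3)) (W n) ≤ Kv)
    {γ C₁ C₂ : ℝ} (hγ : γ = 2 * K^2 + 2 * L^2 * (256 * a * Kψ^2) * Kv)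
    (hC₁ : C₁ = Real.exp ((1 + (512 * a + 2) * γ) * T) * (2 * (1 + T)))
    (hC₂ : C₂ = (a + 512 * a^4 * γ) * C₁ * (2 * T) + 2 * a^3) :
    XNorm h k (2*(M'+3)) N (fun n => V0 n - W0 n) (fun n i => V n i - W n i)
        (fun n => VM n - WM n)
      ≤ (Real.sqrt C₂ + Real.sqrt (a^3) + Real.sqrt C₁)
        * Real.sqrt (YNormSq h k (2*(M'+3)) N
          (fun n => phiP0 h M' B ψ2 V0 V n - phiP0 h M' B ψ2 W0 W n)
          (fun n i => phiP h k M' d ψ1 u0 V0 V VM n i - phiP h k M' d ψ1 u0 W0 W WM n i)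
          (fun n => phiPM h VM n - phiPM h WM n)) := by
  have hk0 : 0 < k := by rw [hk]; positivity
  have hN1 : (1:ℝ) ≤ N := by exact_mod_cast hN0
  have hkT : k ≤ T := by rw [← hN]; nlinarith
  have hT0 : 0 < T := hk0.trans_le hkT
  have hγ0 : 0 ≤ γ := by rw [hγ]; positivity
  have hC₁0 : 0 ≤ C₁ := by rw [hC₁]; positivity
  have hC₂0 : 0 ≤ C₂ := by rw [hC₂]; positivity
  have h_le_a : h ≤ a := by
    have : (1:ℝ) ≤ ((2*(M'+3) : ℕ) : ℝ) := by exact_mod_cast (by omega : 1 ≤ 2*(M'+3))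
    rw [← hM]; nlinarith
  set M := 2*(M'+3) with hMdef
  set P0 : ℕ → ℝ := fun n => phiP0 h M' B ψ2 V0 V n - phiP0 h M' B ψ2 W0 W n with hP0
  set P : ℕ → ℕ → ℝ :=
    fun n i => phiP h k M' d ψ1 u0 V0 V VM n i - phiP h k M' d ψ1 u0 W0 W WM n i with hP
  set PM : ℕ → ℝ := fun n => phiPM h VM n - phiPM h WM n with hPM
  set Y := YNormSq h k M N P0 P PM with hY
  set e : ℕ → ℝ := fun n => normSq h M (fun i => V n i - W n i) with he
  have he0 : ∀ n, 0 ≤ e n := fun n => normSq_nonneg hh.le _ _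
  have hPn : ∀ n, 0 ≤ normSq h M (P n) := fun n => normSq_nonneg hh.le _ _
  have hS0 := starSq_nonneg hk0.le N P0
  have hSM := mul_nonneg hh.le (starSq_nonneg hk0.le N PM)
  have hSP : 0 ≤ ∑ n ∈ Finset.Icc 1 N, k * normSq h M (P n) :=
    Finset.sum_nonneg fun n _ => mul_nonneg hk0.le (hPn n)
  have hYeq : Y = starSq k N P0 + normSq h M (P 0) + h * starSq k N PM
    + ∑ n ∈ Finset.Icc 1 N, k * normSq h M (P n) := rfl
  have hY0 : 0 ≤ Y := by linarith [hPn 0]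
  have hinit : e 0 = normSq h M (P 0) := by
    simp only [he, hP, phiP, if_true, sub_sub_sub_cancel_right]
  have hen : ∀ n ≤ N, e n ≤ C₁ * Y := by
    intro n hn
    have hgr := exp_discrete_gronwall (e := e) (c := k * (1 + (512 * a + 2) * γ)) (N := N)
      (b := fun m => 2 * (1 + T) * (k * (P0 (m-1))^2 + h * (k * (PM (m-1))^2)
        + k * normSq h M (P m))) (by positivity)
      (fun m => by have := hPn m; positivity)
      (fun m hm => by
        have hs := normSq_error_step_le hh ha hr hlam0 hk hlam hcfl hM u0 hψ1 hψ2 hdLip hBLip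
          V0 VM W0 WM V W m (hd m hm.le) (hB m hm.le) (hW m hm.le)
        rw [← hγ] at hs
        change e (m+1) ≤ (1 + k) * ((1 + k * ((512 * a + 2) * γ)) * e m
          + 2 * (k * (P0 m)^2 + h * (k * (PM m)^2) + k * normSq h M (P (m+1)))) at hs
        refine hs.trans ?_
        rw [Nat.add_sub_cancel, mul_add]
        apply add_le_add
        · rw [← mul_assoc]
          apply mul_le_mul_of_nonneg_right _ (he0 m)
          have x1 : 1 + k ≤ Real.exp k := by linarith [Real.add_one_le_exp k]
          have x2 : 1 + k * ((512 * a + 2) * γ) ≤ Real.exp (k * ((512 * a + 2) * γ)) := by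
            linarith [Real.add_one_le_exp (k * ((512 * a + 2) * γ))]
          calc (1 + k) * (1 + k * ((512 * a + 2) * γ))
              ≤ Real.exp k * Real.exp (k * ((512 * a + 2) * γ)) :=
                mul_le_mul x1 x2 (by positivity) (Real.exp_pos _).le
            _ = Real.exp (k * (1 + (512 * a + 2) * γ)) := by rw [← Real.exp_add]; ring_nf
        · have hβ : 0 ≤ k * (P0 m)^2 + h * (k * (PM m)^2) + k * normSq h M (P (m+1)) := by
            have := hPn (m+1); positivity
          have := mul_le_mul_of_nonneg_right hkT hβ
          linarith) n hn
    rw [hinit, ← Finset.mul_sum] at hgr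
    have hres := sum_residuals_le_YNormSq hh.le hk0.le M P0 PM P hn
    rw [← hY] at hres
    have hexp : Real.exp (k * (1 + (512 * a + 2) * γ) * n)
        ≤ Real.exp ((1 + (512 * a + 2) * γ) * T) := by
      apply Real.exp_le_exp.mpr
      have : k * (n:ℝ) ≤ T := by
        rw [← hN]
        exact mul_le_mul_of_nonneg_left (by exact_mod_cast hn) hk0.le
      have := mul_le_mul_of_nonneg_left this (by positivity : 0 ≤ 1 + (512 * a + 2) * γ)
      linarith
    have hsum : normSq h M (P 0) + 2 * (1 + T) * ∑ m ∈ Finset.Icc 1 n, (k * (P0 (m-1))^2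
        + h * (k * (PM (m-1))^2) + k * normSq h M (P m)) ≤ 2 * (1 + T) * Y := by
      have := mul_le_mul_of_nonneg_left hres (by positivity : 0 ≤ 2 * (1 + T))
      have := mul_nonneg hT0.le (hPn 0)
      linarith [hPn 0]
    calc e n ≤ _ := hgr
      _ ≤ Real.exp (k * (1 + (512 * a + 2) * γ) * n) * (2 * (1 + T) * Y) :=
        mul_le_mul_of_nonneg_left hsum (Real.exp_pos _).le
      _ ≤ Real.exp ((1 + (512 * a + 2) * γ) * T) * (2 * (1 + T) * Y) :=
        mul_le_mul_of_nonneg_right hexp (by positivity)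
      _ = C₁ * Y := by rw [hC₁]; ring
  have hleft : ∀ n ≤ N, h^2 * (V0 n - W0 n)^2
      ≤ (a + 512 * a^4 * γ) * (C₁ * Y) + 2 * a^3 * (P0 n)^2 := by
    intro n hn
    have hb := boundary_error_sq_le hh ha hM hψ2 hBLip V0 W0 V W n (hB n hn) (hW n hn)
    rw [← hγ] at hb
    change (1 + h) * (V0 n - W0 n)^2 ≤ (V n 1 - W n 1)^2
      + h * (2 * (P0 n)^2 + 512 * a * γ * e n) at hb
    have h1 : h * (V n 1 - W n 1)^2 ≤ e n :=
      Finset.single_le_sum (f := fun i => h * (V n i - W n i)^2)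
        (fun i _ => by positivity) (Finset.mem_Icc.mpr ⟨le_rfl, by omega⟩)
    have h2 : h^2 * (V0 n - W0 n)^2 ≤ h * e n + h^3 * (2 * (P0 n)^2 + 512 * a * γ * e n) := by
      have x1 := mul_le_mul_of_nonneg_left hb (sq_nonneg h)
      have x2 := mul_le_mul_of_nonneg_left h1 hh.le
      have x3 : 0 ≤ h^3 * (V0 n - W0 n)^2 := by positivity
      linarith
    have h3 : h * e n ≤ a * (C₁ * Y) := mul_le_mul h_le_a (hen n hn) (he0 n) ha
    have h4 : 2 * (P0 n)^2 + 512 * a * γ * e n ≤ 2 * (P0 n)^2 + 512 * a * γ * (C₁ * Y) := by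
      have := mul_le_mul_of_nonneg_left (hen n hn) (by positivity : 0 ≤ 512 * a * γ)
      linarith
    have h5 : h^3 * (2 * (P0 n)^2 + 512 * a * γ * e n)
        ≤ a^3 * (2 * (P0 n)^2 + 512 * a * γ * (C₁ * Y)) :=
      mul_le_mul (pow_le_pow_left₀ hh.le h_le_a 3) h4
        (by have := he0 n; positivity) (by positivity)
    linarith
  have hA : h^2 * starSq k N (fun n => V0 n - W0 n) ≤ C₂ * Y := by
    have h1 : h^2 * starSq k N (fun n => V0 n - W0 n)
        ≤ ∑ n ∈ Finset.range (N+1), (k * ((a + 512 * a^4 * γ) * (C₁ * Y))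
          + 2 * a^3 * (k * (P0 n)^2)) := by
      unfold starSq
      rw [Finset.mul_sum]
      apply Finset.sum_le_sum
      intro n hn
      have hn' := Finset.mem_range.mp hn
      have := mul_le_mul_of_nonneg_left (hleft n (by omega)) hk0.le
      linarith
    rw [Finset.sum_add_distrib, Finset.sum_const, Finset.card_range, nsmul_eq_mul,
      ← Finset.mul_sum] at h1
    change _ ≤ _ + 2 * a^3 * starSq k N P0 at h1
    have h2 : ((N+1 : ℕ) : ℝ) * k ≤ 2 * T := by push_cast; linarith
    have h3 := mul_le_mul_of_nonneg_right h2
      (by positivity : 0 ≤ (a + 512 * a^4 * γ) * (C₁ * Y))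
    have h4 : starSq k N P0 ≤ Y := by linarith [hPn 0]
    have h5 := mul_le_mul_of_nonneg_left h4 (by positivity : 0 ≤ 2 * a^3)
    rw [hC₂]
    linarith
  have hBM : h^2 * starSq k N (fun n => VM n - WM n) ≤ a^3 * Y := by
    have h1 : h^2 * starSq k N (fun n => VM n - WM n) = h^3 * (h * starSq k N PM) := by
      unfold starSq
      rw [Finset.mul_sum, Finset.mul_sum, Finset.mul_sum]
      refine Finset.sum_congr rfl fun n _ => ?_
      rw [hPM]; unfold phiPM; field_simp
    rw [h1]
    exact mul_le_mul (pow_le_pow_left₀ hh.le h_le_a 3) (by linarith [hPn 0]) hSM (by positivity)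
  have x1 := mul_sqrt_le_sqrt hh.le hC₂0 hA
  have x2 := mul_sqrt_le_sqrt hh.le (by positivity) hBM
  have x3 : Finset.sup' (Finset.range (N+1)) ⟨0, Finset.mem_range.mpr (Nat.succ_pos N)⟩
      (fun n => Real.sqrt (e n)) ≤ Real.sqrt C₁ * Real.sqrt Y := by
    apply Finset.sup'_le
    intro n hn
    have hn' := Finset.mem_range.mp hn
    rw [← Real.sqrt_mul hC₁0]
    exact Real.sqrt_le_sqrt (hen n (by omega))
  unfold XNorm
  linarith

/-- A continuous function of two variables is bounded on bounded rectangles. -/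
lemma exists_abs_le_on_rectangle {g : ℝ → ℝ → ℝ} (hg : Continuous (Function.uncurry g)) (a σ : ℝ) :
    ∃ K, ∀ x ∈ Set.Icc 0 a, ∀ s, |s| ≤ σ → |g x s| ≤ K := by
  obtain ⟨K, hK⟩ := (isCompact_Icc.prod isCompact_Icc :
    IsCompact (Set.Icc (0:ℝ) a ×ˢ Set.Icc (-σ) σ)).exists_bound_of_continuousOn hg.continuousOn
  exact ⟨K, fun x hx s hs => hK (x, s) ⟨hx, abs_le.mp hs⟩⟩

lemma exists_abs_le_on_Icc {ψ : ℝ → ℝ} (hψ : Continuous ψ) (a : ℝ) :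
    ∃ K, ∀ x ∈ Set.Icc 0 a, |ψ x| ≤ K :=
  isCompact_Icc.exists_bound_of_continuousOn hψ.continuousOn

/-- **Stability with thresholds `R h`.** Under the consistency hypotheses and the mesh
coupling `k = r h² = λ h` with `λ + 2r ≤ 1`, for each fixed `R > 0` there exist `h₀ > 0`
and `S > 0` such that for all `h ≤ h₀` and all `V_h, W_h ∈ X_h` in the open ball of radius
`R h` around the nodal values `u_h` of the solution,
`‖V_h - W_h‖_{X_h} ≤ S ‖Φ_h(V_h) - Φ_h(W_h)‖_{Y_h}`. -/
theorem stmt_2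
    (adag T : ℝ) (hadag : 0 < adag) (hT : 0 < T)
    (d B : ℝ → ℝ → ℝ) (ψ1 ψ2 u0 : ℝ → ℝ) (u : ℝ → ℝ → ℝ) (s1 s2 : ℝ → ℝ)
    (hs1 : ∀ t : ℝ, s1 t = ∫ x in (0:ℝ)..adag, ψ1 x * u x t)
    (hs2 : ∀ t : ℝ, s2 t = ∫ x in (0:ℝ)..adag, ψ2 x * u x t)
    (hd0 : ∀ x s : ℝ, 0 ≤ d x s) (hB0 : ∀ x s : ℝ, 0 ≤ B x s)
    (hd_smooth : ContDiff ℝ (⊤ : ℕ∞) (Function.uncurry d))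
    (hB_smooth : ContDiff ℝ (⊤ : ℕ∞) (Function.uncurry B))
    (hψ1 : ContDiff ℝ (⊤ : ℕ∞) ψ1) (hψ2 : ContDiff ℝ (⊤ : ℕ∞) ψ2) (hu0 : ContDiff ℝ (⊤ : ℕ∞) u0)
    (L : ℝ) (hL : 0 < L)
    (hdLip : ∀ x s s' : ℝ, |d x s - d x s'| ≤ L * |s - s'|)
    (hBLip : ∀ x s s' : ℝ, |B x s - B x s'| ≤ L * |s - s'|)
    (hu : ContDiff ℝ 3 (Function.uncurry u))
    (hu_bdd : ∀ m : ℕ, m ≤ 3 → ∃ K : ℝ, ∀ p : ℝ × ℝ,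
      ‖iteratedFDeriv ℝ m (Function.uncurry u) p‖ ≤ K)
    (hPDE : ∀ x ∈ Set.Ioo 0 adag, ∀ t ∈ Set.Ioc 0 T,
      deriv (fun τ => u x τ) t + deriv (fun ξ => u ξ t) x + d x (s1 t) * u x t
        = deriv (deriv (fun ξ => u ξ t)) x)
    (hRobin : ∀ t ∈ Set.Icc (0:ℝ) T,
      u 0 t - deriv (fun ξ => u ξ t) 0 = ∫ x in (0:ℝ)..adag, B x (s2 t) * u x t)
    (hinit : ∀ x ∈ Set.Ioo (0:ℝ) adag, u x 0 = u0 x)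
    (hDir : ∀ t ∈ Set.Icc (0:ℝ) T, u adag t = 0)
    (R : ℝ) (hR : 0 < R) :
    ∃ h₀ > 0, ∃ S > 0, ∀ M' N : ℕ, 0 < M' → 0 < N → ∀ r lam : ℝ, 0 < r → 0 < lam →
      let M := 2*(M'+3); let h := adag / (M : ℝ); let k := T / (N : ℝ);
      k = r * h^2 → k = lam * h → lam + 2*r ≤ 1 → h ≤ h₀ →
      ∀ (V0 VM W0 WM : ℕ → ℝ) (V W : ℕ → ℕ → ℝ),
        XNorm h k M N (fun n => V0 n - u 0 ((n:ℝ)*k))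
            (fun n i => V n i - u ((i:ℝ)*h) ((n:ℝ)*k))
            (fun n => VM n - u adag ((n:ℝ)*k)) < R * h →
        XNorm h k M N (fun n => W0 n - u 0 ((n:ℝ)*k))
            (fun n i => W n i - u ((i:ℝ)*h) ((n:ℝ)*k))
            (fun n => WM n - u adag ((n:ℝ)*k)) < R * h →
        XNorm h k M N (fun n => V0 n - W0 n) (fun n i => V n i - W n i)
            (fun n => VM n - WM n)
          ≤ S * Real.sqrt (YNormSq h k M N
              (fun n => phiP0 h M' B ψ2 V0 V n - phiP0 h M' B ψ2 W0 W n)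
              (fun n i => phiP h k M' d ψ1 u0 V0 V VM n i
                - phiP h k M' d ψ1 u0 W0 W WM n i)
              (fun n => phiPM h VM n - phiPM h WM n)) := by
  obtain ⟨Ku, hKu⟩ := hu_bdd 0 (by norm_num)
  have hu_le : ∀ x t : ℝ, |u x t| ≤ Ku := by
    intro x t
    have := hKu (x, t)
    rwa [norm_iteratedFDeriv_zero] at this
  obtain ⟨K1, hK1⟩ := exists_abs_le_on_Icc hψ1.continuous adag
  obtain ⟨K2, hK2⟩ := exists_abs_le_on_Icc hψ2.continuous adag
  set Kψ := max K1 K2 with hKψ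
  have hψ1' : ∀ x ∈ Set.Icc 0 adag, |ψ1 x| ≤ Kψ := fun x hx => (hK1 x hx).trans (le_max_left _ _)
  have hψ2' : ∀ x ∈ Set.Icc 0 adag, |ψ2 x| ≤ Kψ := fun x hx => (hK2 x hx).trans (le_max_right _ _)
  set Kv := 2 * (R * adag)^2 + 2 * (adag * Ku^2) with hKv
  have hKv0 : 0 ≤ Kv := by positivity
  set σ := Real.sqrt (256 * adag * Kψ^2 * Kv) with hσ
  obtain ⟨Kd, hKd⟩ := exists_abs_le_on_rectangle hd_smooth.continuous adag σ
  obtain ⟨KB, hKB⟩ := exists_abs_le_on_rectangle hB_smooth.continuous adag σ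
  set K := max Kd KB with hK
  set γ := 2 * K^2 + 2 * L^2 * (256 * adag * Kψ^2) * Kv with hγ
  set C₁ := Real.exp ((1 + (512 * adag + 2) * γ) * T) * (2 * (1 + T)) with hC₁
  set C₂ := (adag + 512 * adag^4 * γ) * C₁ * (2 * T) + 2 * adag^3 with hC₂
  refine ⟨1, one_pos, Real.sqrt C₂ + Real.sqrt (adag^3) + Real.sqrt C₁,
    by positivity, ?_⟩
  intro M' N _ hN r lam hr hlam M h k hk hkl hcfl _ V0 VM W0 WM V W hV hW
  have hMpos : (0:ℝ) < (M:ℝ) := by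
    have : 0 < M := by simp only [M]; omega
    exact_mod_cast this
  have hh : 0 < h := div_pos hadag hMpos
  have hM : h * (M:ℝ) = adag := div_mul_cancel₀ _ hMpos.ne'
  have hNk : k * (N:ℝ) = T := div_mul_cancel₀ _ (by exact_mod_cast hN.ne')
  have hha : h ≤ adag := by
    have : (1:ℝ) ≤ (M:ℝ) := by
      have : 1 ≤ M := by simp only [M]; omega
      exact_mod_cast this
    rw [← hM]; nlinarith
  have hball : ∀ (Z0 ZM : ℕ → ℝ) (Z : ℕ → ℕ → ℝ),
      XNorm h k M N (fun n => Z0 n - u 0 ((n:ℝ)*k))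
        (fun n i => Z n i - u ((i:ℝ)*h) ((n:ℝ)*k))
        (fun n => ZM n - u adag ((n:ℝ)*k)) < R * h →
      ∀ n ≤ N, normSq h M (Z n) ≤ Kv := by
    intro Z0 ZM Z hZ n hn
    refine normSq_le_of_near hh.le hM (fun i => hu_le ((i:ℝ)*h) ((n:ℝ)*k))
      ((normSq_le_of_XNorm_lt hh.le hZ hn).trans ?_)
    gcongr
  have hQ : ∀ ψ : ℝ → ℝ, (∀ x ∈ Set.Icc 0 adag, |ψ x| ≤ Kψ) → ∀ n ≤ N,
      |Qh h M' (fun j => ψ ((j:ℝ)*h) * V n j)| ≤ σ := by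
    intro ψ hψ n hn
    apply Real.abs_le_sqrt
    exact (Qh_weighted_sq_le hh.le hadag.le hM hψ (V n)).trans
      (mul_le_mul_of_nonneg_left (hball V0 VM V hV n hn) (by positivity))
  exact XNorm_sub_le_of_bounds hh hadag.le hr hlam hk hkl hcfl hM hNk hN hKv0 u0 hψ1' hψ2'
    hdLip hBLip V0 VM W0 WM V W
    (fun n hn x hx => (hKd x hx _ (hQ ψ1 hψ1' n hn)).trans (le_max_left _ _))
    (fun n hn x hx => (hKB x hx _ (hQ ψ2 hψ2' n hn)).trans (le_max_right _ _))
    (hball W0 WM W hW) hγ hC₁ hC₂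
end
end

section
/- Assume B is bounded and Lipschitz in its second variable with constant L, and that for every n the functions x ↦ B(x, s_2(t^n))·u(x,t^n) and x ↦ ψ_2(x)·u(x,t^n) are four times continuously differentiable on [0,a_†] with fourth derivatives bounded uniformly in n. Then there exists C > 0, independent of h, such that for all sufficiently small h, sup_{0≤n≤N} |∫_0^{a_†} B(x, s_2(t^n))u(x,t^n)dx − Q_h(B(Q_h(Ψ_2·u^n))·u^n)| ≤ C·h⁴. -/
open scoped BigOperators

noncomputable section

theorem integral_cubic (c d q₀ q₁ q₂ q₃ : ℝ) :
    ∫ x in c..d, (q₀ + q₁ * (x - c) + q₂ * (x - c) ^ 2 + q₃ * (x - c) ^ 3) =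
      q₀ * (d - c) + q₁ * (d - c) ^ 2 / 2 + q₂ * (d - c) ^ 3 / 3 + q₃ * (d - c) ^ 4 / 4 := by
  have key : ∀ x ∈ Set.uIcc c d, HasDerivAt
      (fun x : ℝ => q₀ * (x - c) + q₁ * (x - c) ^ 2 / 2 + q₂ * (x - c) ^ 3 / 3
        + q₃ * (x - c) ^ 4 / 4)
      (q₀ + q₁ * (x - c) + q₂ * (x - c) ^ 2 + q₃ * (x - c) ^ 3) x := by
    intro x _
    have h1 : HasDerivAt (fun x : ℝ => x - c) 1 x := (hasDerivAt_id x).sub_const c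
    refine ((((h1.const_mul q₀).add (((h1.pow 2).const_mul q₁).div_const 2)).add
      (((h1.pow 3).const_mul q₂).div_const 3)).add
      (((h1.pow 4).const_mul q₃).div_const 4)).congr_deriv ?_
    norm_num
    ring
  rw [intervalIntegral.integral_eq_sub_of_hasDerivAt key
    (by apply Continuous.intervalIntegrable; fun_prop)]
  ring

/-- Integrating a function uniformly close to a cubic. -/
theorem abs_integral_sub_cubic_le {f : ℝ → ℝ} {c d E q₀ q₁ q₂ q₃ : ℝ} (hcd : c ≤ d)
    (hf : ContinuousOn f (Set.Icc c d))
    (hE : ∀ x ∈ Set.Icc c d,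
      |f x - (q₀ + q₁ * (x - c) + q₂ * (x - c) ^ 2 + q₃ * (x - c) ^ 3)| ≤ E) :
    |(∫ x in c..d, f x) - (q₀ * (d - c) + q₁ * (d - c) ^ 2 / 2 + q₂ * (d - c) ^ 3 / 3
      + q₃ * (d - c) ^ 4 / 4)| ≤ E * (d - c) := by
  rw [← integral_cubic, ← intervalIntegral.integral_sub
    (hf.intervalIntegrable_of_Icc hcd) (by apply Continuous.intervalIntegrable; fun_prop)]
  have := intervalIntegral.norm_integral_le_of_norm_le_const (a := c) (b := d) (C := E)
    (f := fun x => f x - (q₀ + q₁ * (x - c) + q₂ * (x - c) ^ 2 + q₃ * (x - c) ^ 3))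
    (fun x hx => by
      rw [Set.uIoc_of_le hcd] at hx
      exact hE x ⟨hx.1.le, hx.2⟩)
  rwa [abs_of_nonneg (sub_nonneg.2 hcd)] at this

theorem exists_cubic_approx {f : ℝ → ℝ} {a K c d : ℝ} (hK : 0 ≤ K)
    (hf : ContDiffOn ℝ 4 f (Set.Icc 0 a))
    (hfK : ∀ x ∈ Set.Icc 0 a, |iteratedDerivWithin 4 f (Set.Icc 0 a) x| ≤ K)
    (hc : 0 ≤ c) (hcd : c < d) (hd : d ≤ a) :
    ∃ q₀ q₁ q₂ q₃ : ℝ, ∀ x ∈ Set.Icc c d,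
      |f x - (q₀ + q₁ * (x - c) + q₂ * (x - c) ^ 2 + q₃ * (x - c) ^ 3)|
        ≤ K * (d - c) ^ 4 / 6 := by
  have hsub : Set.Icc c d ⊆ Set.Icc 0 a := Set.Icc_subset_Icc hc hd
  have ha : (0 : ℝ) < a := by linarith
  have hbound : ∀ y ∈ Set.Icc c d, ‖iteratedDerivWithin (3 + 1) f (Set.Icc c d) y‖ ≤ K := by
    intro y hy
    have heq : iteratedDerivWithin 4 f (Set.Icc c d) y
        = iteratedDerivWithin 4 f (Set.Icc 0 a) y := by
      rw [iteratedDerivWithin_eq_iteratedFDerivWithin, iteratedDerivWithin_eq_iteratedFDerivWithin,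
        iteratedFDerivWithin_subset hsub (uniqueDiffOn_Icc hcd) (uniqueDiffOn_Icc ha) hf hy]
    rw [show 3 + 1 = 4 from rfl, heq]
    exact hfK y (hsub hy)
  refine ⟨f c, derivWithin f (Set.Icc c d) c,
    iteratedDerivWithin 2 f (Set.Icc c d) c / 2, iteratedDerivWithin 3 f (Set.Icc c d) c / 6, ?_⟩
  intro x hx
  have h := taylor_mean_remainder_bound hcd.le
    (n := 3) ((hf.mono hsub).of_le (by norm_num)) hx hbound
  simp only [taylorWithinEval_succ, taylor_within_zero_eval, Real.norm_eq_abs, smul_eq_mul] at h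
  norm_num [Nat.factorial] at h
  have hpow : K * (x - c) ^ 4 / 6 ≤ K * (d - c) ^ 4 / 6 := by
    have := hx.1
    have := hx.2
    have : 0 ≤ x - c := by linarith
    gcongr
  refine le_trans (le_of_eq ?_) (h.trans hpow)
  congr 1
  ring

theorem simpson_panel_error {f : ℝ → ℝ} {a K c h : ℝ} (hK : 0 ≤ K)
    (hf : ContDiffOn ℝ 4 f (Set.Icc 0 a))
    (hfK : ∀ x ∈ Set.Icc 0 a, |iteratedDerivWithin 4 f (Set.Icc 0 a) x| ≤ K)
    (hh : 0 < h) (hc : 0 ≤ c) (hd : c + 2 * h ≤ a) :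
    |(∫ x in c..(c + 2 * h), f x) - h / 3 * (f c + 4 * f (c + h) + f (c + 2 * h))|
      ≤ 32 / 3 * K * h ^ 5 := by
  obtain ⟨q₀, q₁, q₂, q₃, hq⟩ :=
    exists_cubic_approx hK hf hfK hc (show c < c + 2 * h by linarith) hd
  have hi := abs_integral_sub_cubic_le (by linarith)
    (hf.continuousOn.mono (Set.Icc_subset_Icc hc hd)) hq
  have h0 := hq c ⟨by linarith, by linarith⟩
  have h1 := hq (c + h) ⟨by linarith, by linarith⟩
  have h2 := hq (c + 2 * h) ⟨by linarith, by linarith⟩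
  have hE : K * (c + 2 * h - c) ^ 4 / 6 = 8 / 3 * K * h ^ 4 := by ring
  rw [hE] at hi h0 h1 h2
  rw [abs_le] at *
  constructor <;> nlinarith

theorem milne_panel_error {f : ℝ → ℝ} {a K c h : ℝ} (hK : 0 ≤ K)
    (hf : ContDiffOn ℝ 4 f (Set.Icc 0 a))
    (hfK : ∀ x ∈ Set.Icc 0 a, |iteratedDerivWithin 4 f (Set.Icc 0 a) x| ≤ K)
    (hh : 0 < h) (hc : 0 ≤ c) (hd : c + 4 * h ≤ a) :
    |(∫ x in c..(c + 4 * h), f x)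
        - 4 * h / 3 * (2 * f (c + h) - f (c + 2 * h) + 2 * f (c + 3 * h))|
      ≤ 456 * K * h ^ 5 := by
  obtain ⟨q₀, q₁, q₂, q₃, hq⟩ :=
    exists_cubic_approx hK hf hfK hc (show c < c + 4 * h by linarith) hd
  have hi := abs_integral_sub_cubic_le (by linarith)
    (hf.continuousOn.mono (Set.Icc_subset_Icc hc hd)) hq
  have h1 := hq (c + h) ⟨by linarith, by linarith⟩
  have h2 := hq (c + 2 * h) ⟨by linarith, by linarith⟩
  have h3 := hq (c + 3 * h) ⟨by linarith, by linarith⟩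
  have hE : K * (c + 4 * h - c) ^ 4 / 6 = 128 / 3 * K * h ^ 4 := by ring
  rw [hE] at hi h1 h2 h3
  have hKh : 0 ≤ K * h ^ 5 := by positivity
  rw [abs_le] at *
  constructor <;> nlinarith

theorem Qh_error {f : ℝ → ℝ} {a K h : ℝ} {M' : ℕ} (hK : 0 ≤ K) (hM' : 0 < M')
    (hf : ContDiffOn ℝ 4 f (Set.Icc 0 a))
    (hfK : ∀ x ∈ Set.Icc 0 a, |iteratedDerivWithin 4 f (Set.Icc 0 a) x| ≤ K)
    (hh : 0 < h) (ha : (2 * M' + 6 : ℝ) * h = a) :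
    |(∫ x in (0 : ℝ)..a, f x) - Qh h M' (fun i => f (i * h))| ≤ 152 * a * K * h ^ 4 := by
  have hint : ∀ c d : ℝ, 0 ≤ c → c ≤ d → d ≤ a → IntervalIntegrable f MeasureTheory.volume c d :=
    fun c d hc hcd hd =>
      (hf.continuousOn.mono (Set.Icc_subset_Icc hc hd)).intervalIntegrable_of_Icc hcd
  have hMh : 0 < (M' : ℝ) * h := by positivity
  have hM1 : (1 : ℝ) ≤ M' := by exact_mod_cast hM'
  have hM1h : h ≤ M' * h := by nlinarith
  have hmid : ∑ i ∈ Finset.Icc 2 M', ∫ x in (2 * (i : ℝ) * h)..(2 * ((i + 1 : ℕ) : ℝ) * h), f x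
      = ∫ x in (4 * h)..((2 * M' + 2) * h), f x := by
    rw [← Finset.Ico_add_one_right_eq_Icc,
      intervalIntegral.sum_integral_adjacent_intervals_Ico (a := fun i : ℕ => 2 * (i : ℝ) * h)
        (by omega)]
    · congr 1 <;> push_cast <;> ring
    · intro i hi
      have hi2 : (i : ℝ) + 1 ≤ M' + 1 := by exact_mod_cast hi.2
      apply hint
      · positivity
      · push_cast; nlinarith
      · push_cast; nlinarith
  have hmid_err : |∑ i ∈ Finset.Icc 2 M',
      ((∫ x in (2 * (i : ℝ) * h)..(2 * ((i + 1 : ℕ) : ℝ) * h), f x)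
        - h / 3 * (f ((2 * i : ℕ) * h) + 4 * f ((2 * i + 1 : ℕ) * h) + f ((2 * i + 2 : ℕ) * h)))|
      ≤ M' * (32 / 3 * K * h ^ 5) := by
    refine (Finset.abs_sum_le_sum_abs _ _).trans ?_
    refine (Finset.sum_le_card_nsmul _ _ (32 / 3 * K * h ^ 5) ?_).trans ?_
    · intro i hi
      have hi2 : (i : ℝ) ≤ M' := by exact_mod_cast (Finset.mem_Icc.1 hi).2
      have := simpson_panel_error (c := 2 * (i : ℝ) * h) hK hf hfK hh (by positivity)
        (by nlinarith)
      have e0 : 2 * (i : ℝ) * h = ((2 * i : ℕ) : ℝ) * h := by push_cast; ring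
      have e1 : 2 * (i : ℝ) * h + h = ((2 * i + 1 : ℕ) : ℝ) * h := by push_cast; ring
      have e2 : 2 * (i : ℝ) * h + 2 * h = ((2 * i + 2 : ℕ) : ℝ) * h := by push_cast; ring
      have e3 : 2 * ((i + 1 : ℕ) : ℝ) * h = ((2 * i + 2 : ℕ) : ℝ) * h := by push_cast; ring
      rw [e2, e1, e0] at this
      rwa [e3, e0]
    · rw [nsmul_eq_mul]
      gcongr
      simp
  have hleft := milne_panel_error (c := 0) hK hf hfK hh le_rfl (by nlinarith)
  have hright := milne_panel_error (c := (2 * M' + 2) * h) hK hf hfK hh (by positivity)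
    (by nlinarith)
  have hsplit : (∫ x in (0 : ℝ)..a, f x) = (∫ x in (0 : ℝ)..(4 * h), f x)
      + (∫ x in (4 * h)..((2 * M' + 2) * h), f x) + ∫ x in ((2 * M' + 2) * h)..a, f x := by
    rw [intervalIntegral.integral_add_adjacent_intervals,
      intervalIntegral.integral_add_adjacent_intervals] <;> apply hint <;> nlinarith
  rw [Finset.sum_sub_distrib, hmid, ← Finset.mul_sum] at hmid_err
  rw [show (2 * (M' : ℝ) + 2) * h + 4 * h = a by rw [← ha]; ring] at hright
  simp only [zero_add] at hleft
  have hKh : 0 ≤ K * h ^ 5 := by positivity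
  have htotal : M' * (32 / 3 * K * h ^ 5) + 2 * (456 * K * h ^ 5) ≤ 152 * a * K * h ^ 4 := by
    rw [← ha]
    nlinarith [mul_nonneg (Nat.cast_nonneg (α := ℝ) M') hKh]
  have e1 : (2 * (M' : ℝ) + 2) * h + h = ((2 * M' + 3 : ℕ) : ℝ) * h := by push_cast; ring
  have e2 : (2 * (M' : ℝ) + 2) * h + 2 * h = ((2 * M' + 4 : ℕ) : ℝ) * h := by push_cast; ring
  have e3 : (2 * (M' : ℝ) + 2) * h + 3 * h = ((2 * M' + 5 : ℕ) : ℝ) * h := by push_cast; ring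
  rw [e1, e2, e3] at hright
  rw [hsplit]
  simp only [Qh, Nat.cast_one, Nat.cast_ofNat, one_mul]
  rw [abs_le] at *
  constructor <;> linarith

theorem abs_Qh_sub_le {V W : ℕ → ℝ} {h D : ℝ} {M' : ℕ} (hh : 0 ≤ h)
    (hVW : ∀ i ≤ 2 * M' + 6, |V i - W i| ≤ D) :
    |Qh h M' V - Qh h M' W| ≤ 3 * ((2 * M' + 6) * h) * D := by
  have hD : 0 ≤ D := (abs_nonneg _).trans (hVW 0 (by omega))
  have hmid : |∑ i ∈ Finset.Icc 2 M', ((V (2*i) + 4*V (2*i+1) + V (2*i+2))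
      - (W (2*i) + 4*W (2*i+1) + W (2*i+2)))| ≤ M' * (6 * D) := by
    refine (Finset.abs_sum_le_sum_abs _ _).trans ?_
    refine (Finset.sum_le_card_nsmul _ _ (6 * D) ?_).trans ?_
    · intro i hi
      have hi2 := (Finset.mem_Icc.1 hi).2
      have h0 := hVW (2 * i) (by omega)
      have h1 := hVW (2 * i + 1) (by omega)
      have h2 := hVW (2 * i + 2) (by omega)
      rw [abs_le] at *
      constructor <;> linarith
    · rw [nsmul_eq_mul]
      gcongr
      simp
  rw [Finset.sum_sub_distrib] at hmid
  have hmilne : ∀ j, j + 3 ≤ 2 * M' + 6 →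
      |(2 * V (j + 1) - V (j + 2) + 2 * V (j + 3))
        - (2 * W (j + 1) - W (j + 2) + 2 * W (j + 3))| ≤ 5 * D := by
    intro j hj
    have h1 := hVW (j + 1) (by omega)
    have h2 := hVW (j + 2) (by omega)
    have h3 := hVW (j + 3) (by omega)
    rw [abs_le] at *
    constructor <;> linarith
  have hl := hmilne 0 (by omega)
  have hr := hmilne (2 * M' + 2) (by omega)
  have hMD : 0 ≤ M' * h * D := by positivity
  have hhD : 0 ≤ h * D := by positivity
  simp only [zero_add, add_assoc, Nat.reduceAdd] at hl hr hmid
  simp only [Qh, add_assoc] at hmid ⊢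
  rw [abs_le] at *
  constructor <;> nlinarith

/-- Quadrature error for the nonlocal birth term: under boundedness and Lipschitz
continuity of `B` in its second variable, and uniform-in-`n` `C⁴` bounds on
`x ↦ B(x, s_2(tⁿ)) u(x, tⁿ)` and `x ↦ ψ_2(x) u(x, tⁿ)`, there is `C > 0` independent of `h`
such that for all sufficiently small `h`,
`sup_{0≤n≤N} |∫₀^{a†} B(x, s_2(tⁿ)) u(x, tⁿ) dx - Q_h(B(Q_h(Ψ_2·uⁿ))·uⁿ)| ≤ C h⁴`. -/
theorem stmt_6 (adag T L K Bmax Ku : ℝ) (hadag : 0 < adag) (hT : 0 < T) (hL : 0 < L)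
    (hK : 0 ≤ K) (B : ℝ → ℝ → ℝ) (ψ2 : ℝ → ℝ) (u : ℝ → ℝ → ℝ) (N : ℕ) (hN : 0 < N)
    (s2 : ℝ → ℝ)
    (hs2 : ∀ t : ℝ, s2 t = ∫ x in (0:ℝ)..adag, ψ2 x * u x t)
    (hBb : ∀ x ∈ Set.Icc 0 adag, ∀ s : ℝ, |B x s| ≤ Bmax)
    (hBLip : ∀ x ∈ Set.Icc 0 adag, ∀ s s' : ℝ, |B x s - B x s'| ≤ L * |s - s'|)
    (hu_cont : Continuous (Function.uncurry u))
    (hu_bdd : ∀ x t : ℝ, |u x t| ≤ Ku)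
    (hC4B : ∀ n ≤ N,
      ContDiffOn ℝ 4 (fun x => B x (s2 ((n:ℝ)*(T/N))) * u x ((n:ℝ)*(T/N)))
        (Set.Icc 0 adag) ∧
      ∀ x ∈ Set.Icc 0 adag,
        |iteratedDerivWithin 4 (fun x => B x (s2 ((n:ℝ)*(T/N))) * u x ((n:ℝ)*(T/N)))
          (Set.Icc 0 adag) x| ≤ K)
    (hC4ψ : ∀ n ≤ N,
      ContDiffOn ℝ 4 (fun x => ψ2 x * u x ((n:ℝ)*(T/N))) (Set.Icc 0 adag) ∧
      ∀ x ∈ Set.Icc 0 adag,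
        |iteratedDerivWithin 4 (fun x => ψ2 x * u x ((n:ℝ)*(T/N)))
          (Set.Icc 0 adag) x| ≤ K) :
    ∃ C > 0, ∃ h₀ > 0, ∀ M' : ℕ, 0 < M' →
      let h := adag / (2*(M'+3) : ℝ);
      h ≤ h₀ →
      ∀ n ≤ N,
        |(∫ x in (0:ℝ)..adag, B x (s2 ((n:ℝ)*(T/N))) * u x ((n:ℝ)*(T/N)))
            - Qh h M' (fun i =>
                B ((i:ℝ)*h)
                  (Qh h M' (fun j => ψ2 ((j:ℝ)*h) * u ((j:ℝ)*h) ((n:ℝ)*(T/N))))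
                  * u ((i:ℝ)*h) ((n:ℝ)*(T/N)))|
          ≤ C * h^4 := by
  have hKu : 0 ≤ Ku := (abs_nonneg _).trans (hu_bdd 0 0)
  refine ⟨152 * adag * K + 3 * adag * (L * (152 * adag * K) * Ku) + 1, by positivity, 1, one_pos,
    ?_⟩
  intro M' hM' h _ n hn
  have hh : 0 < h := by positivity
  have ha : (2 * M' + 6 : ℝ) * h = adag := by
    simp only [h]
    field_simp
    ring
  set t := (n : ℝ) * (T / N)
  have hS := Qh_error hK hM' (hC4ψ n hn).1 (hC4ψ n hn).2 hh ha
  rw [← hs2 t] at hS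
  have hB := Qh_error hK hM' (hC4B n hn).1 (hC4B n hn).2 hh ha
  set S := Qh h M' (fun j => ψ2 ((j:ℝ)*h) * u ((j:ℝ)*h) t)
  have hpert := abs_Qh_sub_le (M' := M') (D := L * (152 * adag * K * h ^ 4) * Ku)
    (V := fun i => B ((i:ℝ)*h) (s2 t) * u ((i:ℝ)*h) t)
    (W := fun i => B ((i:ℝ)*h) S * u ((i:ℝ)*h) t) hh.le (by
      intro i hi
      have hi' : (i : ℝ) ≤ 2 * M' + 6 := by exact_mod_cast hi
      rw [← sub_mul, abs_mul]
      refine mul_le_mul ((hBLip _ ⟨by positivity, ?_⟩ _ _).trans ?_) (hu_bdd _ _)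
        (abs_nonneg _) (by positivity)
      · rw [← ha]; gcongr
      · gcongr)
  rw [ha] at hpert
  refine (abs_sub_le _ _ _).trans ((add_le_add hB hpert).trans ?_)
  have : 0 < h ^ 4 := by positivity
  linarith
end
end
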